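/- arXiv:2003.01844 — 4 statements merged into one kernel-verified Lean document; each statement's English description precedes it below -/
import Mathlib

section
/- Proposition: If A and B are alternal moulds in ARI(Γ), then ari_u(A,B) is alternal; consequently the set ARI(Γ)_al of alternal moulds is a Lie subalgebra of (ARI(Γ), ari_u). -/
namespace KVMould

/-- A mould over `Γ` in evaluation form: the depth-`m` component
`M m σ x` is the value of the rational function `M^m_{σ₁,…,σₘ}` at the
rational point `x = (x₁,…,xₘ)` (indices are 0-based). -/
abbrev Mould (Γ : Type) : Type := (m : ℕ) → (Fin m → Γ) → (Fin m → ℚ) → ℚ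

variable {Γ : Type} [CommGroup Γ]

/-- `M ∈ ARI(Γ)`: the depth `0` component vanishes. -/
def IsARI (M : Mould Γ) : Prop := ∀ σ x, M 0 σ x = 0

/-- Extension of a tuple of rationals by `0` outside the range. -/
def extQ {m : ℕ} (x : Fin m → ℚ) : ℕ → ℚ := fun i => if h : i < m then x ⟨i, h⟩ else 0

/-- Extension of a tuple of group elements by `1` outside the range. -/
def extG {m : ℕ} (σ : Fin m → Γ) : ℕ → Γ := fun i => if h : i < m then σ ⟨i, h⟩ else 1

/-- The (noncommutative, nonunital on `ARI`) mould product `A × B`. -/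
def mouldMul (A B : Mould Γ) : Mould Γ := fun m σ x =>
  ∑ k ∈ Finset.range (m + 1),
    A k (fun j => extG σ j.val) (fun j => extQ x j.val) *
      B (m - k) (fun j => extG σ (k + j.val)) (fun j => extQ x (k + j.val))

/-- Ecalle's derivation `arit_u(B)(A)` (0-indexed form of the paper's
Definition of `arit_u`; the blocks `k ≤ l` below are 0-based). -/
def aritU (B A : Mould Γ) : Mould Γ := fun m σ x =>
  (∑ k ∈ Finset.range m, ∑ l ∈ Finset.range m,
    if k ≤ l ∧ l + 1 < m then
      A (m - (l - k + 1))
        (fun j => if j.val < k then extG σ j.val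
          else if j.val = k then extG σ (l + 1)
          else extG σ (j.val + (l - k + 1)))
        (fun j => if j.val < k then extQ x j.val
          else if j.val = k then ∑ i ∈ Finset.Icc k (l + 1), extQ x i
          else extQ x (j.val + (l - k + 1))) *
      B (l - k + 1)
        (fun j => extG σ (k + j.val) * (extG σ (l + 1))⁻¹)
        (fun j => extQ x (k + j.val))
    else 0)
  -
  (∑ k ∈ Finset.range m, ∑ l ∈ Finset.range m,
    if 1 ≤ k ∧ k ≤ l then
      A (m - (l - k + 1))
        (fun j => if j.val < k - 1 then extG σ j.val
          else if j.val = k - 1 then extG σ (k - 1)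
          else extG σ (j.val + (l - k + 1)))
        (fun j => if j.val < k - 1 then extQ x j.val
          else if j.val = k - 1 then ∑ i ∈ Finset.Icc (k - 1) l, extQ x i
          else extQ x (j.val + (l - k + 1))) *
      B (l - k + 1)
        (fun j => extG σ (k + j.val) * (extG σ (k - 1))⁻¹)
        (fun j => extQ x (k + j.val))
    else 0)

/-- The `ari_u`-bracket: `ari_u(A,B) = arit_u(B)(A) − arit_u(A)(B) + A×B − B×A`. -/
def ariU (A B : Mould Γ) : Mould Γ :=
  aritU B A - aritU A B + mouldMul A B - mouldMul B A

/-- `preari_u(A,B) = arit_u(B)(A) + A×B`. -/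
def preariU (A B : Mould Γ) : Mould Γ := aritU B A + mouldMul A B

/-- The set of shuffle permutations `Sh(p,q)`. -/
def shuffles (p q : ℕ) : Finset (Equiv.Perm (Fin (p + q))) :=
  Finset.univ.filter fun τ =>
    (∀ i j : Fin (p + q), i.val < j.val → j.val < p → τ⁻¹ i < τ⁻¹ j) ∧
    (∀ i j : Fin (p + q), i.val < j.val → p ≤ i.val → τ⁻¹ i < τ⁻¹ j)

/-- Alternality of a mould. -/
def IsAlternal (M : Mould Γ) : Prop :=
  ∀ p q : ℕ, 1 ≤ p → 1 ≤ q → ∀ (σ : Fin (p + q) → Γ) (x : Fin (p + q) → ℚ),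
    ∑ τ ∈ shuffles p q, M (p + q) (fun i => σ (τ i)) (fun i => x (τ i)) = 0

/-- The `swap` of a mould. -/
def swapM (M : Mould Γ) : Mould Γ := fun m σ v =>
  M m (fun i => ∏ j ∈ Finset.range (m - i.val), extG σ j)
    (fun i => extQ v (m - 1 - i.val) - extQ v (m - i.val))

/-- Bialternality: `M` and `swap(M)` are alternal and the depth `1`
component is even (`M¹(x₁;σ₁) = M¹(−x₁;σ₁⁻¹)`). -/
def IsBialternal (M : Mould Γ) : Prop :=
  IsAlternal M ∧ IsAlternal (swapM M) ∧
    ∀ (σ : Γ) (t : ℚ), M 1 (fun _ => σ) (fun _ => t) = M 1 (fun _ => σ⁻¹) (fun _ => -t)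

/-- The `push` operator. -/
def pushM (M : Mould Γ) : Mould Γ := fun m σ x =>
  M m
    (fun i => if i.val = 0 then (extG σ (m - 1))⁻¹
      else extG σ (i.val - 1) * (extG σ (m - 1))⁻¹)
    (fun i => if i.val = 0 then -(∑ j ∈ Finset.range m, extQ x j)
      else extQ x (i.val - 1))

/-- The `v`-variant `arit_v(B)(A)`. -/
def aritV (B A : Mould Γ) : Mould Γ := fun m σ v =>
  (∑ k ∈ Finset.range m, ∑ l ∈ Finset.range m,
    if k ≤ l ∧ l + 1 < m then
      A (m - (l - k + 1))
        (fun j => if j.val < k then extG σ j.val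
          else if j.val = k then ∏ i ∈ Finset.Icc k (l + 1), extG σ i
          else extG σ (j.val + (l - k + 1)))
        (fun j => if j.val < k then extQ v j.val
          else if j.val = k then extQ v (l + 1)
          else extQ v (j.val + (l - k + 1))) *
      B (l - k + 1)
        (fun j => extG σ (k + j.val))
        (fun j => extQ v (k + j.val) - extQ v (l + 1))
    else 0)
  -
  (∑ k ∈ Finset.range m, ∑ l ∈ Finset.range m,
    if 1 ≤ k ∧ k ≤ l then
      A (m - (l - k + 1))
        (fun j => if j.val < k - 1 then extG σ j.val
          else if j.val = k - 1 then ∏ i ∈ Finset.Icc (k - 1) l, extG σ i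
          else extG σ (j.val + (l - k + 1)))
        (fun j => if j.val < k - 1 then extQ v j.val
          else if j.val = k - 1 then extQ v (k - 1)
          else extQ v (j.val + (l - k + 1))) *
      B (l - k + 1)
        (fun j => extG σ (k + j.val))
        (fun j => extQ v (k + j.val) - extQ v (k - 1))
    else 0)

/-- The `ari_v`-bracket. -/
def ariV (A B : Mould Γ) : Mould Γ :=
  aritV B A - aritV A B + mouldMul A B - mouldMul B A

/-- Pus-neutrality: all cyclic shifts of every component sum to zero. -/
def IsPusNeutral (N : Mould Γ) : Prop :=
  ∀ m : ℕ, 1 ≤ m → ∀ (σ : Fin m → Γ) (v : Fin m → ℚ),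
    ∑ i ∈ Finset.range m,
      N m (fun j => extG σ ((i + j.val) % m)) (fun j => extQ v ((i + j.val) % m)) = 0

/-- The subgroup `Γ^N = {g^N : g ∈ Γ}`. -/
def powSubgroup (Γ : Type) [CommGroup Γ] (N : ℕ) : Subgroup Γ :=
  MonoidHom.range (powMonoidHom N)

/-- The map `i_N : ARI(Γ) → ARI(Γ^N)` (restriction of indices). -/
def iN (N : ℕ) (M : Mould Γ) : Mould (powSubgroup Γ N) := fun m σ x =>
  M m (fun i => (σ i : Γ)) x

/-- The map `m_N : ARI(Γ) → ARI(Γ^N)`. -/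
def mN [Fintype Γ] [DecidableEq Γ] (N : ℕ) (M : Mould Γ) :
    Mould (powSubgroup Γ N) := fun m σ x =>
  ∑ τ ∈ Finset.univ.filter (fun τ : Fin m → Γ => ∀ i, τ i ^ N = (σ i : Γ)),
    M m τ (fun i => (N : ℚ) * x i)

/-- `M` satisfies the distribution relations. -/
def IsARID [Fintype Γ] [DecidableEq Γ] (M : Mould Γ) : Prop :=
  ∀ N : ℕ, 1 ≤ N → N ∣ Fintype.card Γ → iN N M = mN N M

/-- The parallel translation map `t`. -/
def tMap (P : Mould Γ) : Mould Γ := fun m σ v =>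
  if m ≤ 1 then P m σ v
  else P (m - 1) (fun j => extG σ (j.val + 1)) (fun j => extQ v (j.val + 1) - extQ v 0)

/-- `ũ := t ∘ swap`. -/
def uTilde (M : Mould Γ) : Mould Γ := tMap (swapM M)

section Shuffle

variable {α β : Type*}

/-- The list of all shuffles of two words. -/
def shuffleWords : List α → List α → List (List α)
  | [], v => [v]
  | a :: u, [] => [a :: u]
  | a :: u, b :: v =>
    (shuffleWords u (b :: v)).map (a :: ·) ++ (shuffleWords (a :: u) v).map (b :: ·)
  termination_by u v => u.length + v.length

/-- The value of a linear functional on words at the shuffle product `u ⧢ v`. -/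
def shuffleSum (f : List α → ℚ) (u v : List α) : ℚ := ((shuffleWords u v).map f).sum

/-- The value of a bilinear functional at the deconcatenation coproduct of `w`. -/
def deconcSum (F : List α → List α → ℚ) (w : List α) : ℚ :=
  ∑ k ∈ Finset.range (w.length + 1), F (w.take k) (w.drop k)

@[simp] lemma shuffleWords_nil_left (v : List α) : shuffleWords [] v = [v] := by
  simp [shuffleWords]

@[simp] lemma shuffleWords_nil_right (u : List α) : shuffleWords u [] = [u] := by
  cases u <;> simp [shuffleWords]

lemma shuffleWords_cons_cons (a b : α) (u v : List α) :
    shuffleWords (a :: u) (b :: v) =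
      (shuffleWords u (b :: v)).map (a :: ·) ++ (shuffleWords (a :: u) v).map (b :: ·) := by
  rw [shuffleWords]

@[simp] lemma shuffleSum_nil_left (f : List α → ℚ) (v : List α) : shuffleSum f [] v = f v := by
  simp [shuffleSum]

@[simp] lemma shuffleSum_nil_right (f : List α → ℚ) (u : List α) : shuffleSum f u [] = f u := by
  simp [shuffleSum]

lemma shuffleSum_cons_cons (f : List α → ℚ) (a b : α) (u v : List α) :
    shuffleSum f (a :: u) (b :: v) =
      shuffleSum (fun w => f (a :: w)) u (b :: v) +
        shuffleSum (fun w => f (b :: w)) (a :: u) v := by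
  simp [shuffleSum, shuffleWords_cons_cons, Function.comp_def]

@[simp] lemma shuffleSum_zero (u v : List α) : shuffleSum (fun _ => 0) u v = 0 := by
  simp [shuffleSum]

lemma shuffleSum_add (f g : List α → ℚ) (u v : List α) :
    shuffleSum (fun w => f w + g w) u v = shuffleSum f u v + shuffleSum g u v := by
  simp [shuffleSum, List.sum_map_add]

lemma shuffleSum_mul_right (f : List α → ℚ) (c : ℚ) (u v : List α) :
    shuffleSum (fun w => f w * c) u v = shuffleSum f u v * c := by
  simp [shuffleSum, List.sum_map_mul_right]

lemma shuffleSum_mul_left (f : List α → ℚ) (c : ℚ) (u v : List α) :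
    shuffleSum (fun w => c * f w) u v = c * shuffleSum f u v := by
  simp [shuffleSum, List.sum_map_mul_left]

lemma shuffleSum_sub (f g : List α → ℚ) (u v : List α) :
    shuffleSum (fun w => f w - g w) u v = shuffleSum f u v - shuffleSum g u v := by
  have := shuffleSum_add (fun w => f w - g w) g u v
  simp only [sub_add_cancel] at this
  exact eq_sub_of_add_eq this.symm

lemma shuffleSum_finsetSum {ι : Type*} (s : Finset ι) (f : ι → List α → ℚ) (u v : List α) :
    shuffleSum (fun w => ∑ i ∈ s, f i w) u v = ∑ i ∈ s, shuffleSum (f i) u v := by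
  classical
  induction s using Finset.induction_on with
  | empty => simp
  | insert i s hi ih => simp [Finset.sum_insert hi, shuffleSum_add, ih]

lemma shuffleSum_comm (f : List α → ℚ) (u v : List α) :
    shuffleSum f u v = shuffleSum f v u := by
  induction u generalizing f v with
  | nil => simp
  | cons a u ihu =>
    induction v generalizing f with
    | nil => simp
    | cons b v ihv =>
      rw [shuffleSum_cons_cons, shuffleSum_cons_cons, ihu, ihv, add_comm]

lemma shuffleWords_perm {u v w : List α} (h : w ∈ shuffleWords u v) : w.Perm (u ++ v) := by
  induction u generalizing v w with
  | nil => simp_all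
  | cons a u ihu =>
    induction v generalizing w with
    | nil => simp_all
    | cons b v ihv =>
      rw [shuffleWords_cons_cons, List.mem_append, List.mem_map, List.mem_map] at h
      obtain ⟨w, hw, rfl⟩ | ⟨w, hw, rfl⟩ := h
      · exact (ihu hw).cons a
      · exact ((ihv hw).cons b).trans List.perm_middle.symm

lemma shuffleSum_congr {f g : List α → ℚ} {u v : List α}
    (h : ∀ w : List α, w.Perm (u ++ v) → f w = g w) : shuffleSum f u v = shuffleSum g u v := by
  unfold shuffleSum
  rw [List.map_congr_left fun w hw => h w (shuffleWords_perm hw)]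

lemma shuffleWords_map (g : α → β) (u v : List α) :
    shuffleWords (u.map g) (v.map g) = (shuffleWords u v).map (List.map g) := by
  induction u generalizing v with
  | nil => simp
  | cons a u ihu =>
    induction v with
    | nil => simp
    | cons b v ihv =>
      simp only [List.map_cons] at ihu ihv ⊢
      rw [shuffleWords_cons_cons, shuffleWords_cons_cons, ihv, ← List.map_cons, ihu]
      simp [Function.comp_def]

lemma shuffleSum_map (g : α → β) (f : List β → ℚ) (u v : List α) :
    shuffleSum f (u.map g) (v.map g) = shuffleSum (fun w => f (w.map g)) u v := by
  simp [shuffleSum, shuffleWords_map, Function.comp_def]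

@[simp] lemma deconcSum_nil (F : List α → List α → ℚ) : deconcSum F [] = F [] [] := by
  simp [deconcSum]

lemma deconcSum_cons (F : List α → List α → ℚ) (a : α) (w : List α) :
    deconcSum F (a :: w) = F [] (a :: w) + deconcSum (fun x y => F (a :: x) y) w := by
  rw [deconcSum, List.length_cons, Finset.sum_range_succ', add_comm]
  simp [deconcSum]

@[simp] lemma deconcSum_zero (w : List α) : deconcSum (fun _ _ => 0) w = 0 := by
  simp [deconcSum]

lemma deconcSum_add (F G : List α → List α → ℚ) (w : List α) :
    deconcSum (fun x y => F x y + G x y) w = deconcSum F w + deconcSum G w := by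
  simp [deconcSum, Finset.sum_add_distrib]

lemma deconcSum_sub (F G : List α → List α → ℚ) (w : List α) :
    deconcSum (fun x y => F x y - G x y) w = deconcSum F w - deconcSum G w := by
  simp [deconcSum, Finset.sum_sub_distrib]

lemma deconcSum_mul_right (F : List α → List α → ℚ) (c : ℚ) (w : List α) :
    deconcSum (fun x y => F x y * c) w = deconcSum F w * c := by
  simp [deconcSum, Finset.sum_mul]

lemma deconcSum_comm (F : List α → List α → List α → List α → ℚ) (u v : List α) :
    deconcSum (fun u₁ u₂ => deconcSum (fun v₁ v₂ => F u₁ u₂ v₁ v₂) v) u =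
      deconcSum (fun v₁ v₂ => deconcSum (fun u₁ u₂ => F u₁ u₂ v₁ v₂) u) v :=
  Finset.sum_comm

lemma shuffleSum_deconcSum_comm (F : List α → List α → List α → ℚ) (u v w : List α) :
    shuffleSum (fun a => deconcSum (F a) w) u v =
      deconcSum (fun x y => shuffleSum (fun a => F a x y) u v) w :=
  shuffleSum_finsetSum _ _ _ _

lemma shuffleSum_shuffleSum_comm (F : List α → List α → ℚ) (u v u' v' : List α) :
    shuffleSum (fun a => shuffleSum (F a) u' v') u v =
      shuffleSum (fun b => shuffleSum (fun a => F a b) u v) u' v' := by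
  induction u generalizing F v with
  | nil => simp
  | cons a u ihu =>
    induction v generalizing F with
    | nil => simp
    | cons b v ihv => simp only [shuffleSum_cons_cons _ a b, shuffleSum_add, ihu, ihv]

lemma deconcSum_eq_nil_left {F : List α → List α → ℚ} {w : List α}
    (h : ∀ a x y, F (a :: x) y = 0) : deconcSum F w = F [] w := by
  cases w with
  | nil => simp
  | cons a w =>
    rw [deconcSum_cons]
    simp [h, deconcSum]

lemma deconcSum_eq_nil_right {F : List α → List α → ℚ} {w : List α}
    (h : ∀ x a y, F x (a :: y) = 0) : deconcSum F w = F w [] := by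
  induction w generalizing F with
  | nil => simp
  | cons a w ih => rw [deconcSum_cons, h, ih fun x b y => h (a :: x) b y, zero_add]

/-- Deconcatenation is multiplicative for the shuffle product. -/
lemma shuffleSum_deconcSum (F : List α → List α → ℚ) (u v : List α) :
    shuffleSum (deconcSum F) u v =
      deconcSum (fun u₁ u₂ => deconcSum (fun v₁ v₂ =>
        shuffleSum (fun a => shuffleSum (fun b => F a b) u₂ v₂) u₁ v₁) v) u := by
  induction u generalizing F v with
  | nil => simp
  | cons a u ihu =>
    induction v generalizing F with
    | nil => simp
    | cons b v ihv =>
      rw [shuffleSum_cons_cons]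
      simp only [deconcSum_cons, shuffleSum_add]
      rw [ihu, ihv]
      simp only [deconcSum_cons, deconcSum_add, shuffleSum_nil_left, shuffleSum_nil_right,
        shuffleSum_cons_cons (fun w => F [] w),
        shuffleSum_cons_cons (fun w => shuffleSum (fun b => F w b) _ _)]
      ring

/-- Shuffles of a word with a marked letter, organised around that letter. -/
lemma shuffleSum_append_cons (f : List α → ℚ) (u : List α) (c : α) (u' v : List α) :
    shuffleSum f (u ++ c :: u') v =
      deconcSum (fun v₁ v₂ =>
        shuffleSum (fun a => shuffleSum (fun d => f (a ++ c :: d)) u' v₂) u v₁) v := by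
  induction u generalizing f v with
  | nil =>
    induction v generalizing f with
    | nil => simp
    | cons b v ihv =>
      rw [List.nil_append] at ihv ⊢
      rw [shuffleSum_cons_cons, ihv, deconcSum_cons]
      simp
  | cons a u ihu =>
    induction v generalizing f with
    | nil => simp
    | cons b v ihv =>
      rw [List.cons_append] at ihv ⊢
      rw [shuffleSum_cons_cons, ihv, ihu]
      simp only [deconcSum_cons, deconcSum_add, shuffleSum_nil_right,
        shuffleSum_cons_cons (fun w => shuffleSum _ _ _), List.cons_append]
      ring

lemma nodup_shuffleWords {u v : List α} (h : (u ++ v).Nodup) : (shuffleWords u v).Nodup := by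
  induction u generalizing v with
  | nil => simp
  | cons a u ihu =>
    induction v with
    | nil => simp
    | cons b v ihv =>
      rw [shuffleWords_cons_cons]
      refine List.Nodup.append ((ihu ?_).map (List.cons_injective))
        ((ihv ?_).map (List.cons_injective)) ?_
      · exact (List.nodup_cons.1 h).2
      · exact h.sublist (by simp)
      · intro w hw hw'
        obtain ⟨w₁, -, rfl⟩ := List.mem_map.1 hw
        obtain ⟨w₂, -, he⟩ := List.mem_map.1 hw'
        have : b = a := (List.cons.inj he).1
        simp [this] at h

lemma mem_shuffleWords_iff [DecidableEq α] {u v w : List α} (h : (u ++ v).Nodup) :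
    w ∈ shuffleWords u v ↔ w.Perm (u ++ v) ∧
      u.Pairwise (fun i j => w.idxOf i < w.idxOf j) ∧
      v.Pairwise (fun i j => w.idxOf i < w.idxOf j) := by
  have hself : ∀ {l : List α}, l.Nodup → l.Pairwise (fun i j => l.idxOf i < l.idxOf j) := by
    intro l hl
    rw [List.pairwise_iff_getElem]
    intro i j hi hj hij
    rwa [hl.idxOf_getElem, hl.idxOf_getElem]
  have heq : ∀ {l w : List α}, l.Nodup → w.Perm l →
      l.Pairwise (fun i j => w.idxOf i < w.idxOf j) → w = l := by
    intro l w hl hw hp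
    have hwn : w.Nodup := hw.nodup_iff.2 hl
    refine hw.eq_of_pairwise (le := fun i j => w.idxOf i < w.idxOf j) ?_ (hself hwn) hp
    intro a b _ _ h₁ h₂
    exact absurd h₁ h₂.not_gt
  have hcons : ∀ {c : α} {l w : List α}, c ∉ l →
      (l.Pairwise (fun i j => (c :: w).idxOf i < (c :: w).idxOf j) ↔
        l.Pairwise (fun i j => w.idxOf i < w.idxOf j)) := by
    intro c l w hc
    refine List.Pairwise.iff_of_mem fun {i j} hi hj => ?_
    rw [List.idxOf_cons_ne _ (by rintro rfl; exact hc hi),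
      List.idxOf_cons_ne _ (by rintro rfl; exact hc hj),
      Nat.succ_lt_succ_iff]
  have hhead : ∀ {c a : α} {l w : List α}, c ∈ a :: l →
      (a :: l).Pairwise (fun i j => (c :: w).idxOf i < (c :: w).idxOf j) → c = a := by
    intro c a l w hc hp
    rcases List.mem_cons.1 hc with rfl | hc
    · rfl
    · have := (List.pairwise_cons.1 hp).1 c hc
      simp at this
  have hconsself : ∀ {c : α} {l w : List α}, c ∉ l →
      ((c :: l).Pairwise (fun i j => (c :: w).idxOf i < (c :: w).idxOf j) ↔
        l.Pairwise (fun i j => w.idxOf i < w.idxOf j)) := by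
    intro c l w hc
    rw [List.pairwise_cons, hcons hc, and_iff_right]
    intro x hx
    rw [List.idxOf_cons_self, List.idxOf_cons_ne _ (by rintro rfl; exact hc hx)]
    exact Nat.succ_pos _
  induction w generalizing u v with
  | nil =>
    cases u <;> cases v <;> simp [shuffleWords_cons_cons]
  | cons c w ih =>
    match u, v with
    | [], v =>
      rw [List.nil_append] at h ⊢
      refine ⟨fun hw => ?_, fun hw => by simp [heq h hw.1 hw.2.2]⟩
      rw [shuffleWords_nil_left, List.mem_singleton] at hw
      exact ⟨hw ▸ .refl _, .nil, hw ▸ hself (hw ▸ h)⟩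
    | a :: u, [] =>
      rw [List.append_nil] at h ⊢
      refine ⟨fun hw => ?_, fun hw => by simp [heq h hw.1 hw.2.1]⟩
      rw [shuffleWords_nil_right, List.mem_singleton] at hw
      exact ⟨hw ▸ .refl _, hw ▸ hself (hw ▸ h), .nil⟩
    | a :: u, b :: v =>
      have hu : (u ++ b :: v).Nodup := (List.nodup_cons.1 h).2
      have hv : (a :: u ++ v).Nodup := h.sublist (by simp)
      have hab : a ≠ b := by rintro rfl; simp at h
      have hau : a ∉ u := by simp at h; tauto
      have hav : a ∉ b :: v := by simp at h; simp; tauto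
      have hbv : b ∉ v := (List.nodup_cons.1 (List.nodup_append.1 hu).2.1).1
      have hbu : b ∉ a :: u := by simp at h; simp; grind
      rw [shuffleWords_cons_cons]
      by_cases hca : c = a
      · subst hca
        have : c :: w ∈ (shuffleWords u (b :: v)).map (c :: ·) ++
            (shuffleWords (c :: u) v).map (b :: ·) ↔ w ∈ shuffleWords u (b :: v) := by
          simp [hab.symm]
        refine this.trans ((ih hu).trans ?_)
        rw [hconsself hau, hcons hav, List.cons_append, List.perm_cons]
      · by_cases hcb : c = b
        · subst hcb
          have : c :: w ∈ (shuffleWords u (c :: v)).map (a :: ·) ++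
              (shuffleWords (a :: u) v).map (c :: ·) ↔ w ∈ shuffleWords (a :: u) v := by
            simp [hab]
          refine this.trans ((ih hv).trans ?_)
          rw [hconsself hbv, hcons hbu, List.perm_middle.congr_right,
            List.perm_cons]
        · have : c :: w ∉ (shuffleWords u (b :: v)).map (a :: ·) ++
              (shuffleWords (a :: u) v).map (b :: ·) := by
            simp [Ne.symm hca, Ne.symm hcb]
          refine ⟨fun hw => absurd hw this, fun ⟨hp, h₁, h₂⟩ => ?_⟩
          have hc : c ∈ (a :: u) ++ b :: v := hp.subset (by simp)
          rcases List.mem_append.1 hc with hc | hc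
          · exact absurd (hhead hc h₁) hca
          · exact absurd (hhead hc h₂) hcb

lemma sum_shuffles_eq_shuffleSum (p q : ℕ) (f : List (Fin (p + q)) → ℚ) :
    ∑ τ ∈ shuffles p q, f (List.ofFn τ) =
      shuffleSum f (List.ofFn (Fin.castAdd q)) (List.ofFn (Fin.natAdd p)) := by
  have happ : List.ofFn (Fin.castAdd q) ++ List.ofFn (Fin.natAdd p) =
      List.ofFn (@id (Fin (p + q))) := by
    rw [← List.ofFn_fin_append]
    congr 1
    funext i
    refine Fin.addCases (fun i => ?_) (fun i => ?_) i <;> simp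
  have hnodup : (List.ofFn (Fin.castAdd (n := p) q) ++ List.ofFn (Fin.natAdd (m := q) p)).Nodup := by
    rw [happ, List.nodup_ofFn]
    exact Function.injective_id
  have hidx (τ : Equiv.Perm (Fin (p + q))) (i : Fin (p + q)) :
      (List.ofFn τ).idxOf i = (τ⁻¹ i : Fin (p + q)) := by
    have h := (List.nodup_ofFn.2 τ.injective).idxOf_getElem (τ⁻¹ i : Fin (p + q)) (by simp)
    simpa using h
  have hmem (τ : Equiv.Perm (Fin (p + q))) : τ ∈ shuffles p q ↔ List.ofFn τ ∈
      shuffleWords (List.ofFn (Fin.castAdd (n := p) q)) (List.ofFn (Fin.natAdd (m := q) p)) := by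
    rw [mem_shuffleWords_iff hnodup, happ, and_iff_right, List.pairwise_ofFn, List.pairwise_ofFn]
    · simp only [hidx, shuffles, Finset.mem_filter, Finset.mem_univ, true_and, Fin.val_fin_lt]
      refine and_congr ⟨fun h i j hij => h _ _ (by simpa) (by simp), fun h i j hij hj => ?_⟩
        ⟨fun h i j hij => h _ _ (by simpa) (by simp), fun h i j hij hi => ?_⟩
      · exact h (i := ⟨i, by omega⟩) (j := ⟨j, by omega⟩) hij
      · have := h (i := ⟨i - p, by omega⟩) (j := ⟨j - p, by omega⟩) (by simp; omega)
        convert this using 2 <;> ext <;> simp <;> omega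
    · refine (List.perm_ext_iff_of_nodup (List.nodup_ofFn.2 τ.injective)
        (List.nodup_ofFn.2 Function.injective_id)).2 fun i => ?_
      simp [List.mem_ofFn, τ.surjective i]
  rw [shuffleSum, ← List.sum_toFinset f (nodup_shuffleWords hnodup)]
  refine Finset.sum_nbij (fun τ => List.ofFn τ) (fun τ hτ => ?_) (fun τ _ τ' _ h => ?_)
    (fun w hw => ?_) (fun _ _ => rfl)
  · simpa using (hmem τ).1 hτ
  · exact Equiv.coe_fn_injective (List.ofFn_injective h)
  · have hw : w ∈ shuffleWords (List.ofFn (Fin.castAdd (n := p) q))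
      (List.ofFn (Fin.natAdd (m := q) p)) := by simpa using hw
    have hp := shuffleWords_perm hw
    have hlen : w.length = p + q := by simpa using hp.length_eq
    have hinj : Function.Injective fun i : Fin (p + q) => w.get (i.cast hlen.symm) :=
      (List.nodup_iff_injective_get.1 (hp.nodup_iff.2 hnodup)).comp (Fin.cast_injective _)
    have hofFn : List.ofFn (Equiv.ofBijective _ (Finite.injective_iff_bijective.1 hinj)) = w := by
      refine List.ext_getElem (by simp [hlen]) fun i _ _ => ?_
      simp
    refine ⟨Equiv.ofBijective _ (Finite.injective_iff_bijective.1 hinj), ?_, hofFn⟩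
    rw [Finset.mem_coe, hmem, hofFn]
    exact hw

/-- A functional on words that vanishes on shuffles of nonempty words. -/
def VanishesOnShuffles (f : List α → ℚ) : Prop :=
  ∀ u v : List α, u ≠ [] → v ≠ [] → shuffleSum f u v = 0

/-- A bilinear functional vanishing on shuffles in each variable is
primitive-like on deconcatenated shuffles. -/
lemma shuffleSum_deconcSum_of_vanishes {F : List α → List α → ℚ}
    (hl : ∀ b, VanishesOnShuffles fun a => F a b) (hr : ∀ a, VanishesOnShuffles (F a))
    {u v : List α} (hu : u ≠ []) (hv : v ≠ []) :
    shuffleSum (deconcSum F) u v = F u v + F v u := by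
  obtain ⟨a, u, rfl⟩ := List.exists_cons_of_ne_nil hu
  have hnil : deconcSum (fun v₁ v₂ =>
      shuffleSum (fun x => shuffleSum (fun y => F x y) (a :: u) v₂) [] v₁) v = F v (a :: u) := by
    simp only [shuffleSum_nil_left]
    rw [deconcSum_eq_nil_right fun x b y => hr x _ _ (by simp) (by simp), shuffleSum_nil_right]
  have hcons : ∀ u₁ u₂ : List α, deconcSum (fun v₁ v₂ =>
      shuffleSum (fun x => shuffleSum (fun y => F x y) u₂ v₂) (a :: u₁) v₁) v =
        shuffleSum (F (a :: u₁)) u₂ v := by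
    intro u₁ u₂
    rw [deconcSum_eq_nil_left, shuffleSum_nil_right]
    intro b x y
    rw [shuffleSum_shuffleSum_comm]
    simp [hl _ (a :: u₁) (b :: x) (by simp) (by simp)]
  rw [shuffleSum_deconcSum, deconcSum_cons, hnil]
  simp only [hcons]
  rw [deconcSum_eq_nil_right fun x b y => hr (a :: x) (b :: y) v (by simp) hv,
    shuffleSum_nil_left, add_comm]

/-- Deconcatenation into three factors is multiplicative for the shuffle product. -/
lemma shuffleSum_deconcSum_deconcSum (H : List α → List α → List α → ℚ) (u v : List α) :
    shuffleSum (fun w => deconcSum (fun a r => deconcSum (fun e d => H a e d) r) w) u v =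
      deconcSum (fun u₁ r => deconcSum (fun u₂ u₃ => deconcSum (fun v₁ s =>
        deconcSum (fun v₂ v₃ => shuffleSum (fun a => shuffleSum (fun e =>
          shuffleSum (fun d => H a e d) u₃ v₃) u₂ v₂) u₁ v₁) s) v) r) u := by
  rw [shuffleSum_deconcSum]
  congr! 3 with u₁ r
  rw [deconcSum_comm (fun u₂ u₃ v₁ s => deconcSum (fun v₂ v₃ => shuffleSum (fun a =>
    shuffleSum (fun e => shuffleSum (fun d => H a e d) u₃ v₃) u₂ v₂) u₁ v₁) s)]
  congr! 3 with v₁ s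
  have h (a : List α) := shuffleSum_deconcSum (H a) r s
  simp only [h]
  rw [shuffleSum_deconcSum_comm]
  simp only [shuffleSum_deconcSum_comm]

theorem vanishesOnShuffles_mul_comm {A B : List (α) → ℚ} (hA : VanishesOnShuffles A)
    (hB : VanishesOnShuffles B) : VanishesOnShuffles fun w =>
      deconcSum (fun x y => A x * B y) w - deconcSum (fun x y => B x * A y) w := by
  have key {C D : List (α) → ℚ} (hC : VanishesOnShuffles C) (hD : VanishesOnShuffles D)
      {u v : List (α)} (hu : u ≠ []) (hv : v ≠ []) :
      shuffleSum (deconcSum fun x y => C x * D y) u v = C u * D v + C v * D u := by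
    refine shuffleSum_deconcSum_of_vanishes (fun b u v hu hv => ?_) (fun a u v hu hv => ?_) hu hv
    · rw [shuffleSum_mul_right, hC u v hu hv, zero_mul]
    · rw [shuffleSum_mul_left, hD u v hu hv, mul_zero]
  intro u v hu hv
  rw [shuffleSum_sub]
  linear_combination key hA hB hu hv - key hB hA hu hv

end Shuffle

section Words

variable {Γ : Type} [CommGroup Γ]

/-- The summand of `arit_u` attached to the letter `c` and the block `b`, in the surroundings
`a` and `d`; it depends bilinearly on the words `[c]` and `b`. -/
def flexionTerm (A B : List (Γ × ℚ) → ℚ) (a d : List (Γ × ℚ)) :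
    List (Γ × ℚ) → List (Γ × ℚ) → ℚ
  | [c], b => A (a ++ (c.1, c.2 + (b.map Prod.snd).sum) :: d) *
      B (b.map fun y => (y.1 * c.1⁻¹, y.2))
  | _, _ => 0

lemma flexionTerm_eq_zero (A B : List (Γ × ℚ) → ℚ) (a d b : List (Γ × ℚ))
    {s : List (Γ × ℚ)} (hs : s.length ≠ 1) : flexionTerm A B a d s b = 0 := by
  match s with
  | [] => rfl
  | [_] => simp at hs
  | _ :: _ :: _ => rfl

/-- `arit_u` as an operator on functionals on words. -/
def aritWord (A B : List (Γ × ℚ) → ℚ) (w : List (Γ × ℚ)) : ℚ :=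
  deconcSum (fun a r => deconcSum (fun e d => deconcSum (fun x y =>
    flexionTerm A B a d y x - flexionTerm A B a d x y) e) r) w

lemma vanishesOnShuffles_flexionTerm_left (A B : List (Γ × ℚ) → ℚ) (a d b : List (Γ × ℚ)) :
    VanishesOnShuffles fun s => flexionTerm A B a d s b := by
  intro u v hu hv
  rw [← shuffleSum_zero u v]
  refine shuffleSum_congr fun w hw => flexionTerm_eq_zero _ _ _ _ _ ?_
  have := hw.length_eq
  have := List.length_pos_iff.2 hu
  have := List.length_pos_iff.2 hv
  rw [List.length_append] at *
  omega

lemma vanishesOnShuffles_flexionTerm_right (A : List (Γ × ℚ) → ℚ) {B : List (Γ × ℚ) → ℚ}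
    (hB : VanishesOnShuffles B) (a d s : List (Γ × ℚ)) :
    VanishesOnShuffles (flexionTerm A B a d s) := by
  intro u v hu hv
  match s with
  | [] => exact shuffleSum_zero u v
  | _ :: _ :: _ => exact shuffleSum_zero u v
  | [c] =>
    have h : shuffleSum (flexionTerm A B a d [c]) u v = shuffleSum (fun b =>
        A (a ++ (c.1, c.2 + ((u ++ v).map Prod.snd).sum) :: d) *
          B (b.map fun y => (y.1 * c.1⁻¹, y.2))) u v :=
      shuffleSum_congr fun w hw => by rw [flexionTerm, (hw.map Prod.snd).sum_eq]
    rw [h, shuffleSum_mul_left, ← shuffleSum_map, hB _ _ (by simpa) (by simpa), mul_zero]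

/-- The middle factor of `aritWord` vanishes on shuffles: contributions of a block and a letter
coming from different words cancel. -/
lemma vanishesOnShuffles_flexionTerm_comm (A : List (Γ × ℚ) → ℚ) {B : List (Γ × ℚ) → ℚ}
    (hB : VanishesOnShuffles B) (a d : List (Γ × ℚ)) :
    VanishesOnShuffles fun e => deconcSum (fun x y =>
      flexionTerm A B a d y x - flexionTerm A B a d x y) e := by
  intro u v hu hv
  have hl := vanishesOnShuffles_flexionTerm_left A B a d
  have hr := vanishesOnShuffles_flexionTerm_right A hB a d
  have h₁ := shuffleSum_deconcSum_of_vanishes hl hr hu hv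
  have h₂ := shuffleSum_deconcSum_of_vanishes (F := fun x y => flexionTerm A B a d y x) hr hl hu hv
  simp only [deconcSum_sub]
  rw [shuffleSum_sub]
  linear_combination h₂ - h₁

/-- Contributions of a block and a letter coming from the same word add up to a shuffle. -/
lemma deconcSum_shuffleSum_flexionTerm {A : List (Γ × ℚ) → ℚ} (hA : VanishesOnShuffles A)
    (B : List (Γ × ℚ) → ℚ) (u u' s b : List (Γ × ℚ)) {v : List (Γ × ℚ)} (hv : v ≠ []) :
    deconcSum (fun v₁ v₂ => shuffleSum (fun a => shuffleSum (fun d =>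
      flexionTerm A B a d s b) u' v₂) u v₁) v = 0 := by
  match s with
  | [] => simp [flexionTerm]
  | _ :: _ :: _ => simp [flexionTerm]
  | [c] =>
    have h := hA (u ++ (c.1, c.2 + (b.map Prod.snd).sum) :: u') v (by simp) hv
    rw [shuffleSum_append_cons] at h
    simp only [flexionTerm, shuffleSum_mul_right, deconcSum_mul_right, h, zero_mul]

lemma deconcSum_shuffleSum_flexionTerm_comm {A : List (Γ × ℚ) → ℚ} (hA : VanishesOnShuffles A)
    (B : List (Γ × ℚ) → ℚ) (u u' e : List (Γ × ℚ)) {v : List (Γ × ℚ)} (hv : v ≠ []) :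
    deconcSum (fun v₁ v₂ => shuffleSum (fun a => shuffleSum (fun d => deconcSum (fun x y =>
      flexionTerm A B a d y x - flexionTerm A B a d x y) e) u' v₂) u v₁) v = 0 := by
  simp only [shuffleSum_deconcSum_comm]
  rw [deconcSum_comm (fun v₁ v₂ x y => shuffleSum (fun a => shuffleSum (fun d =>
      flexionTerm A B a d y x - flexionTerm A B a d x y) u' v₂) u v₁)]
  simp only [shuffleSum_sub, deconcSum_sub, deconcSum_shuffleSum_flexionTerm hA B u u' _ _ hv]
  simp

theorem vanishesOnShuffles_aritWord {A B : List (Γ × ℚ) → ℚ} (hA : VanishesOnShuffles A)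
    (hB : VanishesOnShuffles B) : VanishesOnShuffles (aritWord A B) := by
  intro u v hu hv
  set H : List (Γ × ℚ) → List (Γ × ℚ) → List (Γ × ℚ) → ℚ := fun a e d =>
    deconcSum (fun x y => flexionTerm A B a d y x - flexionTerm A B a d x y) e with hH
  have hmid (u₂ u₃ v₂ v₃ a : List (Γ × ℚ)) (hu₂ : u₂ ≠ []) (hv₂ : v₂ ≠ []) :
      shuffleSum (fun e => shuffleSum (fun d => H a e d) u₃ v₃) u₂ v₂ = 0 := by
    rw [shuffleSum_shuffleSum_comm]
    simp only [hH, vanishesOnShuffles_flexionTerm_comm A hB a _ u₂ v₂ hu₂ hv₂, shuffleSum_zero]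
  have hright (u₁ x u₃ : List (Γ × ℚ)) (c : Γ × ℚ) :
      deconcSum (fun v₁ s => deconcSum (fun v₂ v₃ => shuffleSum (fun a => shuffleSum (fun e =>
        shuffleSum (fun d => H a e d) u₃ v₃) (c :: x) v₂) u₁ v₁) s) v = 0 := by
    rw [← deconcSum_shuffleSum_flexionTerm_comm hA B u₁ u₃ (c :: x) hv]
    congr! 3 with v₁ s
    rw [deconcSum_eq_nil_left fun b y z => ?_]
    · simp only [shuffleSum_nil_right, hH]
    · simp only [hmid (c :: x) u₃ (b :: y) z _ (by simp) (by simp), shuffleSum_zero]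
  have hleft (v₁ v₂ v₃ : List (Γ × ℚ)) :
      deconcSum (fun u₁ u₃ => shuffleSum (fun a => shuffleSum (fun d => H a v₂ d) u₃ v₃) u₁ v₁) u
        = 0 := by
    rw [← deconcSum_shuffleSum_flexionTerm_comm hA B v₁ v₃ v₂ hu]
    congr! 3 with u₁ u₃
    rw [shuffleSum_comm]
    congr! 2 with a
    rw [shuffleSum_comm]
  change shuffleSum (fun w => deconcSum (fun a r => deconcSum (fun e d => H a e d) r) w) u v = 0
  rw [shuffleSum_deconcSum_deconcSum]
  have hcollapse (u₁ r : List (Γ × ℚ)) := deconcSum_eq_nil_left (w := r)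
    (F := fun u₂ u₃ => deconcSum (fun v₁ s => deconcSum (fun v₂ v₃ => shuffleSum (fun a =>
      shuffleSum (fun e => shuffleSum (fun d => H a e d) u₃ v₃) u₂ v₂) u₁ v₁) s) v)
    fun c x u₃ => hright u₁ x u₃ c
  simp only [hcollapse, shuffleSum_nil_left]
  rw [deconcSum_comm (fun u₁ u₃ v₁ s => deconcSum (fun v₂ v₃ => shuffleSum (fun a =>
    shuffleSum (fun d => H a v₂ d) u₃ v₃) u₁ v₁) s)]
  have hswap (v₁ s : List (Γ × ℚ)) : deconcSum (fun u₁ u₃ => deconcSum (fun v₂ v₃ =>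
      shuffleSum (fun a => shuffleSum (fun d => H a v₂ d) u₃ v₃) u₁ v₁) s) u = 0 := by
    rw [deconcSum_comm (fun u₁ u₃ v₂ v₃ =>
      shuffleSum (fun a => shuffleSum (fun d => H a v₂ d) u₃ v₃) u₁ v₁)]
    simp only [hleft, deconcSum_zero]
  simp only [hswap, deconcSum_zero]

/-- A mould as a functional on words in the letters `(σᵢ, xᵢ)`. -/
def wordMould (M : Mould Γ) (w : List (Γ × ℚ)) : ℚ :=
  M w.length (fun i => w[i].1) (fun i => w[i].2)

lemma eq_wordMould (M : Mould Γ) {n : ℕ} {σ : Fin n → Γ} {x : Fin n → ℚ} (w : List (Γ × ℚ))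
    (hn : w.length = n) (h : ∀ (i : ℕ) (hi : i < n), w.getD i (1, 0) = (σ ⟨i, hi⟩, x ⟨i, hi⟩)) :
    M n σ x = wordMould M w := by
  subst hn
  unfold wordMould
  congr 1 <;> funext i <;> have := h i i.2 <;>
    rw [List.getD_eq_getElem _ _ i.2] at this <;> simp [this]

lemma wordMould_ofFn (M : Mould Γ) {n : ℕ} (σ : Fin n → Γ) (x : Fin n → ℚ) :
    wordMould M (List.ofFn fun i => (σ i, x i)) = M n σ x :=
  (eq_wordMould M _ (by simp) fun i hi => by
    rw [List.getD_eq_getElem _ _ (by simpa)]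
    simp).symm

lemma extG_getElem (w : List (Γ × ℚ)) (i : ℕ) :
    extG (fun j : Fin w.length => w[j].1) i = (w.getD i (1, 0)).1 := by
  unfold extG
  split_ifs with h
  · rw [List.getD_eq_getElem _ _ h]; rfl
  · rw [List.getD_eq_default _ _ (not_lt.1 h)]

lemma extQ_getElem (w : List (Γ × ℚ)) (i : ℕ) :
    extQ (fun j : Fin w.length => w[j].2) i = (w.getD i (1, 0)).2 := by
  unfold extQ
  split_ifs with h
  · rw [List.getD_eq_getElem _ _ h]; rfl
  · rw [List.getD_eq_default _ _ (not_lt.1 h)]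

lemma isAlternal_iff_vanishesOnShuffles (M : Mould Γ) :
    IsAlternal M ↔ VanishesOnShuffles (wordMould M) := by
  have key (p q : ℕ) (σ : Fin (p + q) → Γ) (x : Fin (p + q) → ℚ) :
      ∑ τ ∈ shuffles p q, M (p + q) (fun i => σ (τ i)) (fun i => x (τ i)) =
        shuffleSum (wordMould M) (List.ofFn fun i => (σ (Fin.castAdd q i), x (Fin.castAdd q i)))
          (List.ofFn fun i => (σ (Fin.natAdd p i), x (Fin.natAdd p i))) := by
    have h := sum_shuffles_eq_shuffleSum p q fun l => wordMould M (l.map fun i => (σ i, x i))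
    rw [← shuffleSum_map] at h
    simp only [List.map_ofFn, Function.comp_def, wordMould_ofFn] at h
    exact h
  constructor
  · intro h u v hu hv
    have hp := List.length_pos_iff.2 hu
    have hq := List.length_pos_iff.2 hv
    have h := h u.length v.length hp hq
      (Fin.append (fun i => u[i].1) (fun i => v[i].1))
      (Fin.append (fun i => u[i].2) (fun i => v[i].2))
    rw [key] at h
    simpa using h
  · intro h p q hp hq σ x
    rw [key]
    refine h _ _ ?_ ?_ <;> simp [List.ofFn_eq_nil_iff] <;> omega

lemma wordMould_mouldMul (A B : Mould Γ) (w : List (Γ × ℚ)) :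
    wordMould (mouldMul A B) w = deconcSum (fun x y => wordMould A x * wordMould B y) w := by
  rw [wordMould, mouldMul, deconcSum]
  refine Finset.sum_congr rfl fun k hk => ?_
  have hk := Finset.mem_range.1 hk
  congr 1
  · refine eq_wordMould A _ (by simp; omega) fun i hi => ?_
    rw [extG_getElem, extQ_getElem]
    grind
  · refine eq_wordMould B _ (by simp) fun i hi => ?_
    rw [extG_getElem, extQ_getElem]
    grind

lemma deconcSum_flexionTerm_left (A B : List (Γ × ℚ) → ℚ) (a d e : List (Γ × ℚ)) (c : Γ × ℚ) :
    deconcSum (flexionTerm A B a d) (c :: e) = flexionTerm A B a d [c] e := by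
  rw [deconcSum, Finset.sum_eq_single 1]
  · simp
  · intro k hk hk'
    have := Finset.mem_range.1 hk
    refine flexionTerm_eq_zero _ _ _ _ _ ?_
    simp at *
    omega
  · simp

lemma deconcSum_flexionTerm_right (A B : List (Γ × ℚ) → ℚ) (a d e : List (Γ × ℚ)) (c : Γ × ℚ) :
    deconcSum (fun x y => flexionTerm A B a d y x) (e ++ [c]) = flexionTerm A B a d [c] e := by
  rw [deconcSum, Finset.sum_eq_single e.length]
  · simp
  · intro k hk hk'
    have := Finset.mem_range.1 hk
    refine flexionTerm_eq_zero _ _ _ _ _ ?_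
    simp at *
    omega
  · simp

lemma aritWord_eq_sum (A : List (Γ × ℚ) → ℚ) (B : List (Γ × ℚ) → ℚ)
    (w : List (Γ × ℚ)) :
    aritWord A B w = ∑ k ∈ Finset.range w.length, ∑ j ∈ Finset.range (w.length - k),
      (flexionTerm A B (w.take k) (w.drop (k + j + 1)) [w.getD (k + j) (1, 0)]
          ((w.drop k).take j) -
        flexionTerm A B (w.take k) (w.drop (k + j + 1)) [w.getD k (1, 0)]
          ((w.drop (k + 1)).take j)) := by
  rw [aritWord, deconcSum, Finset.sum_range_succ]
  have hlast : deconcSum (fun e d => deconcSum (fun x y => flexionTerm A B (w.take w.length) d y x -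
      flexionTerm A B (w.take w.length) d x y) e) (w.drop w.length) = 0 := by simp
  rw [hlast, add_zero]
  refine Finset.sum_congr rfl fun k hk => ?_
  have hk := Finset.mem_range.1 hk
  rw [deconcSum, Finset.sum_range_succ']
  simp only [List.take_zero, deconcSum_nil, sub_self, add_zero, List.length_drop]
  refine Finset.sum_congr rfl fun j hj => ?_
  have hj := Finset.mem_range.1 hj
  rw [deconcSum_sub, List.drop_drop]
  congr 1
  · rw [← deconcSum_flexionTerm_right]
    congr 1
    rw [List.getD_eq_getElem _ _ (by omega), List.take_succ_eq_append_getElem (by simp; omega)]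
    simp
  · rw [← deconcSum_flexionTerm_left]
    congr 1
    rw [List.getD_eq_getElem _ _ hk, List.drop_eq_getElem_cons hk, List.take_succ_cons]

lemma sum_Ico_getD (w : List (Γ × ℚ)) (k j : ℕ) (h : k + j ≤ w.length) :
    ∑ i ∈ Finset.Ico k (k + j), (w.getD i (1, 0)).2 =
      (((w.drop k).take j).map Prod.snd).sum := by
  induction j with
  | zero => simp
  | succ j ih =>
    rw [← add_assoc, Finset.sum_Ico_succ_top (by omega), ih (by omega),
      List.take_succ_eq_append_getElem (by simp; omega), List.getD_eq_getElem _ _ (by omega)]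
    simp

lemma wordMould_aritU (A : Mould Γ) {B : Mould Γ} (hB : IsARI B) (w : List (Γ × ℚ)) :
    wordMould (aritU B A) w = aritWord (wordMould A) (wordMould B) w := by
  have hB₀ : wordMould B [] = 0 := hB _ _
  have hflex (a d : List (Γ × ℚ)) (c : Γ × ℚ) :
      flexionTerm (wordMould A) (wordMould B) a d [c] [] = 0 := by
    simp [flexionTerm, hB₀]
  rw [aritWord_eq_sum]
  simp only [Finset.sum_sub_distrib]
  rw [wordMould, aritU]
  simp only [extG_getElem, extQ_getElem]
  congr 1
  · refine Finset.sum_congr rfl fun k hk => ?_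
    have hk := Finset.mem_range.1 hk
    obtain ⟨r, hr⟩ : ∃ r, w.length = k + r + 1 := ⟨w.length - k - 1, by omega⟩
    rw [← Finset.sum_filter, show w.length - k = r + 1 by omega, Finset.sum_range_succ',
      List.take_zero, hflex, add_zero]
    refine Finset.sum_nbij' (fun l => l - k) (fun j => k + j) ?_ ?_ ?_ ?_ ?_
    · intro l hl
      simp only [Finset.mem_filter, Finset.mem_range] at hl ⊢
      omega
    · intro j hj
      simp only [Finset.mem_filter, Finset.mem_range] at hj ⊢
      omega
    · intro l hl
      simp only [Finset.mem_filter, Finset.mem_range] at hl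
      omega
    · intro j _
      omega
    · intro l hl
      simp only [Finset.mem_filter, Finset.mem_range] at hl
      obtain ⟨j, rfl⟩ := Nat.exists_eq_add_of_le hl.2.1
      have hj : k + j + 1 < w.length := hl.2.2
      have hsum : ∑ i ∈ Finset.Icc k (k + j + 1), (w.getD i (1, 0)).2 =
          (w.getD (k + j + 1) (1, 0)).2 + (((w.drop k).take (j + 1)).map Prod.snd).sum := by
        rw [← sum_Ico_getD _ _ _ (by omega), ← Finset.Ico_succ_right_eq_Icc, Nat.succ_eq_succ,
          Nat.succ_eq_add_one, Finset.sum_Ico_succ_top (by omega), add_comm, add_assoc]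
      rw [Nat.add_sub_cancel_left, hsum, flexionTerm]
      refine congrArg₂ (· * ·) (eq_wordMould A _ ?_ fun i hi => ?_)
        (eq_wordMould B _ ?_ fun i hi => ?_)
      · simp
        omega
      · grind
      · simp
        omega
      · grind
  · obtain hw | ⟨n, hn⟩ : w.length = 0 ∨ ∃ n, w.length = n + 1 := by
      cases w.length <;> simp
    · simp [hw]
    rw [hn, Finset.sum_range_succ']
    simp only [nonpos_iff_eq_zero, one_ne_zero, false_and, if_false, Finset.sum_const_zero,
      add_zero]
    rw [Finset.sum_range_succ _ n, add_tsub_cancel_left, Finset.sum_range_one, List.take_zero,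
      hflex, add_zero]
    refine Finset.sum_congr rfl fun k hk => ?_
    have hk := Finset.mem_range.1 hk
    obtain ⟨r, rfl⟩ : ∃ r, n = k + r := ⟨n - k, by omega⟩
    rw [← Finset.sum_filter, show k + r + 1 - k = r + 1 by omega, Finset.sum_range_succ' _ r,
      List.take_zero, hflex, add_zero]
    refine Finset.sum_nbij' (fun l => l - (k + 1)) (fun j => k + 1 + j) ?_ ?_ ?_ ?_ ?_
    · intro l hl
      simp only [Finset.mem_filter, Finset.mem_range] at hl ⊢
      omega
    · intro j hj
      simp only [Finset.mem_filter, Finset.mem_range] at hj ⊢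
      omega
    · intro l hl
      simp only [Finset.mem_filter, Finset.mem_range] at hl
      omega
    · intro j _
      omega
    · intro l hl
      simp only [Finset.mem_filter, Finset.mem_range] at hl
      obtain ⟨j, rfl⟩ := Nat.exists_eq_add_of_le hl.2.2
      have hj : k + 1 + j < w.length := by omega
      have hsum : ∑ i ∈ Finset.Icc k (k + 1 + j), (w.getD i (1, 0)).2 =
          (w.getD k (1, 0)).2 + (((w.drop (k + 1)).take (j + 1)).map Prod.snd).sum := by
        rw [← sum_Ico_getD _ _ _ (by omega), ← Finset.Ico_succ_right_eq_Icc, Nat.succ_eq_succ,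
          Nat.succ_eq_add_one, Finset.sum_eq_sum_Ico_succ_bot (by omega), add_assoc (k + 1)]
      rw [Nat.add_sub_cancel_left, Nat.add_sub_cancel, hsum, flexionTerm]
      refine congrArg₂ (· * ·) (eq_wordMould A _ ?_ fun i hi => ?_)
        (eq_wordMould B _ ?_ fun i hi => ?_)
      · simp
        omega
      · grind
      · simp
        omega
      · grind

end Words

/-- Proposition: the `ari_u`-bracket of alternal ARI moulds is alternal
(and again an ARI mould); hence `ARI(Γ)_al` is a Lie subalgebra. -/
theorem ariU_alternal (Γ : Type) [CommGroup Γ] [Fintype Γ]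
    (A B : Mould Γ) (hA : IsARI A) (hB : IsARI B)
    (hAal : IsAlternal A) (hBal : IsAlternal B) :
    IsAlternal (ariU A B) ∧ IsARI (ariU A B) := by
  have hA' := (isAlternal_iff_vanishesOnShuffles A).1 hAal
  have hB' := (isAlternal_iff_vanishesOnShuffles B).1 hBal
  refine ⟨(isAlternal_iff_vanishesOnShuffles _).2 fun u v hu hv => ?_, fun σ x => ?_⟩
  · have h : wordMould (ariU A B) = fun w =>
        aritWord (wordMould A) (wordMould B) w - aritWord (wordMould B) (wordMould A) w +
          (deconcSum (fun x y => wordMould A x * wordMould B y) w -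
            deconcSum (fun x y => wordMould B x * wordMould A y) w) := by
      funext w
      rw [← wordMould_aritU A hB, ← wordMould_aritU B hA, ← wordMould_mouldMul,
        ← wordMould_mouldMul, ← add_sub_assoc]
      rfl
    rw [h, shuffleSum_add, shuffleSum_sub, vanishesOnShuffles_aritWord hA' hB' u v hu hv,
      vanishesOnShuffles_aritWord hB' hA' u v hu hv,
      vanishesOnShuffles_mul_comm hA' hB' u v hu hv]
    simp
  · simp [ariU, aritU, mouldMul, hA _ _, hB _ _]

end KVMould
end

section
/- Lemma: Every alternal mould M ∈ ARI(Γ) is mantar-invariant, i.e. for all m ≥ 1 and all σ_1,…,σ_m ∈ Γ one has M^m(x_1,…,x_m ; σ_1,…,σ_m) = (−1)^{m−1} M^m(x_m,…,x_1 ; σ_m,…,σ_1). -/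
namespace KVMould

variable {Γ : Type} [CommGroup Γ]

/-- The permutations `τ` for which `τ⁻¹` strictly decreases up to position `k` and strictly
increases from position `k` on. -/
def valleys (n k : ℕ) : Finset (Equiv.Perm (Fin n)) :=
  Finset.univ.filter fun τ =>
    (∀ i j : Fin n, i < j → j.val ≤ k → τ⁻¹ j < τ⁻¹ i) ∧
    (∀ i j : Fin n, i < j → k ≤ i.val → τ⁻¹ i < τ⁻¹ j)

/-- The permutations `τ` for which `τ⁻¹` strictly decreases on the first `p` positions and
strictly increases on the remaining ones. -/
def revShuffles (n p : ℕ) : Finset (Equiv.Perm (Fin n)) :=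
  Finset.univ.filter fun τ =>
    (∀ i j : Fin n, i < j → j.val < p → τ⁻¹ j < τ⁻¹ i) ∧
    (∀ i j : Fin n, i < j → p ≤ i.val → τ⁻¹ i < τ⁻¹ j)

/-- The permutation of `Fin (p + q)` reversing the first `p` positions. -/
def revPrefix (p q : ℕ) : Equiv.Perm (Fin (p + q)) :=
  Function.Involutive.toPerm
    (fun i => if h : i.val < p then ⟨p - 1 - i.val, by omega⟩ else i) (by
      intro i
      dsimp only
      split_ifs <;> first | rfl | (ext; dsimp only at *; omega))

theorem revPrefix_val (p q : ℕ) (i : Fin (p + q)) :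
    (revPrefix p q i).val = if i.val < p then p - 1 - i.val else i.val := by
  change Fin.val (if h : i.val < p then (⟨p - 1 - i.val, _⟩ : Fin (p + q)) else i) = _
  split_ifs <;> rfl

theorem revPrefix_revPrefix (p q : ℕ) (i : Fin (p + q)) : revPrefix p q (revPrefix p q i) = i :=
  (revPrefix p q).symm_apply_apply i

theorem revPrefix_inv (p q : ℕ) : (revPrefix p q)⁻¹ = revPrefix p q := rfl

theorem mem_shuffles_iff_revPrefix_mul_mem (p q : ℕ) (τ : Equiv.Perm (Fin (p + q))) :
    τ ∈ shuffles p q ↔ revPrefix p q * τ ∈ revShuffles (p + q) p := by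
  simp only [shuffles, revShuffles, Finset.mem_filter, Finset.mem_univ, true_and, mul_inv_rev,
    revPrefix_inv, Equiv.Perm.mul_apply]
  have hv := revPrefix_val p q
  constructor
  · rintro ⟨h₁, h₂⟩
    refine ⟨fun i j hij hj => h₁ _ _ ?_ ?_, fun i j hij hi => h₂ _ _ ?_ ?_⟩ <;>
      simp only [hv] <;> split_ifs <;> omega
  · rintro ⟨h₁, h₂⟩
    refine ⟨fun i j hij hj => ?_, fun i j hij hi => ?_⟩
    · have := h₁ (revPrefix p q j) (revPrefix p q i)
        (by rw [Fin.lt_def, hv, hv]; split_ifs <;> omega) (by rw [hv]; split_ifs <;> omega)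
      simpa only [revPrefix_revPrefix] using this
    · have := h₂ (revPrefix p q i) (revPrefix p q j)
        (by rw [Fin.lt_def, hv, hv]; split_ifs <;> omega) (by rw [hv]; split_ifs <;> omega)
      simpa only [revPrefix_revPrefix] using this

theorem disjoint_valleys_succ {n k : ℕ} (hk : k + 1 < n) :
    Disjoint (valleys n k) (valleys n (k + 1)) := by
  rw [Finset.disjoint_left]
  intro τ h h'
  simp only [valleys, Finset.mem_filter, Finset.mem_univ, true_and] at h h'
  have hlt : (⟨k, by omega⟩ : Fin n) < ⟨k + 1, hk⟩ := Nat.lt_succ_self k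
  exact lt_asymm (h.2 _ _ hlt le_rfl) (h'.1 _ _ hlt le_rfl)

theorem valleys_union_valleys_succ {n k : ℕ} (hk : k + 1 < n) :
    valleys n k ∪ valleys n (k + 1) = revShuffles n (k + 1) := by
  ext τ
  simp only [valleys, revShuffles, Finset.mem_union, Finset.mem_filter, Finset.mem_univ, true_and]
  have hlt : (⟨k, by omega⟩ : Fin n) < ⟨k + 1, hk⟩ := Nat.lt_succ_self k
  constructor
  · rintro (⟨h₁, h₂⟩ | ⟨h₁, h₂⟩)
    · exact ⟨fun i j hij hj => h₁ i j hij (by omega), fun i j hij hi => h₂ i j hij (by omega)⟩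
    · exact ⟨fun i j hij hj => h₁ i j hij (by omega), fun i j hij hi => h₂ i j hij (by omega)⟩
  · rintro ⟨h₁, h₂⟩
    rcases lt_or_gt_of_ne (τ⁻¹.injective.ne hlt.ne) with h | h
    · refine Or.inl ⟨fun i j hij hj => h₁ i j hij (by omega), fun i j hij hi => ?_⟩
      rcases hi.lt_or_eq with hi | rfl
      · exact h₂ i j hij hi
      · rcases (show i.val + 1 ≤ j.val from hij).lt_or_eq with hj | hj
        · exact h.trans (h₂ _ j hj le_rfl)
        · rwa [show j = ⟨i.val + 1, hk⟩ from Fin.ext hj.symm]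
    · refine Or.inr ⟨fun i j hij hj => ?_, fun i j hij hi => h₂ i j hij hi⟩
      rcases hj.lt_or_eq with hj | hj
      · exact h₁ i j hij hj
      · obtain rfl : j = ⟨k + 1, hk⟩ := Fin.ext hj
        rcases (Nat.le_of_lt_succ hij).lt_or_eq with hi | hi
        · exact h.trans (h₁ i _ hi (Nat.lt_succ_self k))
        · rwa [show i = ⟨k, by omega⟩ from Fin.ext hi]

theorem eq_one_of_strictMono {n : ℕ} {τ : Equiv.Perm (Fin n)} (h : StrictMono τ) : τ = 1 :=
  Equiv.ext fun i => congrFun ((h.range_inj strictMono_id).mp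
    (τ.surjective.range_eq.trans Function.surjective_id.range_eq.symm)) i

theorem valleys_zero (n : ℕ) : valleys n 0 = {1} := by
  ext τ
  simp only [valleys, Finset.mem_filter, Finset.mem_univ, true_and, Finset.mem_singleton]
  constructor
  · rintro ⟨-, h⟩
    exact inv_eq_one.mp (eq_one_of_strictMono fun i j hij => h i j hij (Nat.zero_le _))
  · rintro rfl
    exact ⟨fun i j hij hj => by omega, fun i j hij _ => hij⟩

theorem valleys_last (n : ℕ) : valleys n (n - 1) = {Fin.revPerm} := by
  ext τ
  simp only [valleys, Finset.mem_filter, Finset.mem_univ, true_and, Finset.mem_singleton]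
  constructor
  · rintro ⟨h, -⟩
    have h_mono : StrictMono (τ⁻¹ * Fin.revPerm : Equiv.Perm (Fin n)) := fun i j hij =>
      h _ _ (Fin.rev_lt_rev.mpr hij) (by omega)
    exact inv_mul_eq_one.mp (eq_one_of_strictMono h_mono)
  · rintro rfl
    exact ⟨fun i j hij _ => Fin.rev_lt_rev.mpr hij, fun i j hij hi => by omega⟩

theorem IsAlternal.sum_revShuffles {M : Mould Γ} (hal : IsAlternal M) {n p : ℕ} (hp : 1 ≤ p)
    (hpn : p < n) (σ : Fin n → Γ) (x : Fin n → ℚ) :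
    ∑ τ ∈ revShuffles n p, M n (fun i => σ (τ i)) (fun i => x (τ i)) = 0 := by
  obtain ⟨q, rfl⟩ := Nat.exists_eq_add_of_le hpn.le
  rw [← hal p q hp (by omega) (fun i => σ (revPrefix p q i)) (fun i => x (revPrefix p q i))]
  symm
  exact Finset.sum_equiv (Equiv.mulLeft (revPrefix p q))
    (mem_shuffles_iff_revPrefix_mul_mem p q) fun τ _ => rfl

theorem IsAlternal.sum_valleys {M : Mould Γ} (hal : IsAlternal M) {n : ℕ} (σ : Fin n → Γ)
    (x : Fin n → ℚ) (k : ℕ) (hk : k < n) :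
    ∑ τ ∈ valleys n k, M n (fun i => σ (τ i)) (fun i => x (τ i)) = (-1 : ℚ) ^ k * M n σ x := by
  induction k with
  | zero => simp [valleys_zero]
  | succ k ih =>
    have h := hal.sum_revShuffles (Nat.succ_pos k) hk σ x
    rw [Nat.succ_eq_add_one, ← valleys_union_valleys_succ hk,
      Finset.sum_union (disjoint_valleys_succ hk), ih (by omega)] at h
    rw [pow_succ]
    linarith

/-- Lemma: every alternal mould in `ARI(Γ)` is `mantar`-invariant. -/
theorem alternal_mantar_invariant (Γ : Type) [CommGroup Γ] [Fintype Γ]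
    (M : Mould Γ) (hM : IsARI M) (hal : IsAlternal M)
    (m : ℕ) (hm : 1 ≤ m) (σ : Fin m → Γ) (x : Fin m → ℚ) :
    M m σ x = (-1 : ℚ) ^ (m - 1) * M m (fun i => σ i.rev) (fun i => x i.rev) := by
  have h := hal.sum_valleys σ x (m - 1) (by omega)
  rw [valleys_last, Finset.sum_singleton] at h
  simp only [Fin.revPerm_apply] at h
  rw [h, ← mul_assoc, ← mul_pow]
  norm_num

end KVMould
end

section
/- Proposition: If A and B are bialternal moulds in ARI(Γ), then ari_u(A,B) is bialternal; consequently the set ARI(Γ)_{al/al} of bialternal moulds is a Lie subalgebra of (ARI(Γ), ari_u). -/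
namespace KVMould

variable {Γ : Type} [CommGroup Γ]

section Words

variable {α β γ : Type*}

/-- The sum of `f` over a multiset. -/
def msum (s : Multiset α) (f : α → ℚ) : ℚ := (s.map f).sum

lemma msum_congr {s : Multiset α} {f g : α → ℚ} (h : ∀ a ∈ s, f a = g a) :
    msum s f = msum s g := by
  unfold msum; rw [Multiset.map_congr rfl h]

@[simp] lemma msum_zero_fun (s : Multiset α) : msum s (fun _ => 0) = 0 := by simp [msum]

@[simp] lemma msum_singleton (a : α) (f : α → ℚ) : msum {a} f = f a := by simp [msum]

@[simp] lemma msum_cons (a : α) (s : Multiset α) (f : α → ℚ) :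
    msum (a ::ₘ s) f = f a + msum s f := by simp [msum]

@[simp] lemma msum_union (s t : Multiset α) (f : α → ℚ) :
    msum (s + t) f = msum s f + msum t f := by simp [msum]

@[simp] lemma msum_map (s : Multiset α) (g : α → β) (f : β → ℚ) :
    msum (s.map g) f = msum s (fun a => f (g a)) := by simp [msum]

lemma msum_add (s : Multiset α) (f g : α → ℚ) :
    msum s (fun a => f a + g a) = msum s f + msum s g := by simp [msum]

lemma msum_sub (s : Multiset α) (f g : α → ℚ) :
    msum s (fun a => f a - g a) = msum s f - msum s g := by simp [msum]

lemma msum_neg (s : Multiset α) (f : α → ℚ) :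
    msum s (fun a => - f a) = - msum s f := by simp [msum]

lemma msum_mul_right (s : Multiset α) (f : α → ℚ) (c : ℚ) :
    msum s (fun a => f a * c) = msum s f * c := by
  simp [msum, Multiset.sum_map_mul_right]

lemma msum_mul_left (s : Multiset α) (f : α → ℚ) (c : ℚ) :
    msum s (fun a => c * f a) = c * msum s f := by
  simp [msum, Multiset.sum_map_mul_left]

lemma msum_comm (s : Multiset α) (t : Multiset β) (f : α → β → ℚ) :
    msum s (fun a => msum t (f a)) = msum t (fun b => msum s (fun a => f a b)) :=
  Multiset.sum_map_sum_map s t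

/-- The multiset of shuffles of two words. -/
def sh : List α → List α → Multiset (List α)
  | [], v => {v}
  | a :: u, [] => {a :: u}
  | a :: u, b :: v => (sh u (b :: v)).map (List.cons a) + (sh (a :: u) v).map (List.cons b)
termination_by u v => u.length + v.length

/-- All ways to cut a word into two consecutive pieces. -/
def spl : List α → Multiset (List α × List α)
  | [] => {([], [])}
  | a :: w => ([], a :: w) ::ₘ (spl w).map (fun s => (a :: s.1, s.2))

/-- All ways to single out a letter of a word, with what precedes and what follows it. -/
def pick : List α → Multiset (List α × α × List α)
  | [] => 0
  | a :: w => ([], a, w) ::ₘ (pick w).map (fun e => (a :: e.1, e.2.1, e.2.2))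

@[simp] lemma sh_nil_left (v : List α) : sh [] v = {v} := by simp [sh]

@[simp] lemma sh_nil_right (u : List α) : sh u [] = {u} := by cases u <;> simp [sh]

lemma sh_cons_cons (a b : α) (u v : List α) :
    sh (a :: u) (b :: v) =
      (sh u (b :: v)).map (List.cons a) + (sh (a :: u) v).map (List.cons b) := by
  rw [sh]

lemma sh_comm (u v : List α) : sh u v = sh v u := by
  induction u generalizing v with
  | nil => simp
  | cons a u ihu =>
    induction v with
    | nil => simp
    | cons b v ihv => rw [sh_cons_cons, sh_cons_cons, ihu, ihv, add_comm]

lemma sh_map (φ : α → β) (u v : List α) :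
    sh (u.map φ) (v.map φ) = (sh u v).map (List.map φ) := by
  induction u generalizing v with
  | nil => simp
  | cons a u ihu =>
    induction v with
    | nil => simp
    | cons b v ihv =>
      have h1 := ihu (b :: v)
      simp only [List.map_cons] at h1 ihv ⊢
      rw [sh_cons_cons, sh_cons_cons, h1, ihv]
      simp [Multiset.map_map]

lemma perm_of_mem_sh {u v w : List α} (h : w ∈ sh u v) : w.Perm (u ++ v) := by
  induction u generalizing v w with
  | nil => simp at h; simp [h]
  | cons a u ihu =>
    induction v generalizing w with
    | nil => simp at h; simp [h]
    | cons b v ihv =>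
      simp only [sh_cons_cons, Multiset.mem_add, Multiset.mem_map] at h
      rcases h with ⟨w', hw', rfl⟩ | ⟨w', hw', rfl⟩
      · exact (ihu hw').cons a
      · exact ((ihv hw').cons b).trans List.perm_middle.symm

@[simp] lemma msum_spl_nil (f : List α × List α → ℚ) : msum (spl []) f = f ([], []) := by
  simp [spl]

@[simp] lemma msum_spl_cons (a : α) (w : List α) (f : List α × List α → ℚ) :
    msum (spl (a :: w)) f = f ([], a :: w) + msum (spl w) (fun s => f (a :: s.1, s.2)) := by
  simp [spl]

@[simp] lemma msum_pick_nil (f : List α × α × List α → ℚ) : msum (pick []) f = 0 := by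
  simp [pick, msum]

@[simp] lemma msum_pick_cons (a : α) (w : List α) (f : List α × α × List α → ℚ) :
    msum (pick (a :: w)) f =
      f ([], a, w) + msum (pick w) (fun e => f (a :: e.1, e.2.1, e.2.2)) := by
  simp [pick]

lemma msum_sh_cons_cons (a b : α) (u v : List α) (f : List α → ℚ) :
    msum (sh (a :: u) (b :: v)) f =
      msum (sh u (b :: v)) (fun w => f (a :: w)) +
        msum (sh (a :: u) v) (fun w => f (b :: w)) := by
  simp [sh_cons_cons]

/-- Deconcatenation is multiplicative for the shuffle product. -/
lemma msum_sh_spl (u v : List α) (f : List α × List α → ℚ) :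
    msum (sh u v) (fun w => msum (spl w) f) =
      msum (spl u) fun s => msum (spl v) fun t =>
        msum (sh s.1 t.1) fun p => msum (sh s.2 t.2) fun q => f (p, q) := by
  induction u generalizing v f with
  | nil => simp
  | cons a u ihu =>
    induction v generalizing f with
    | nil => simp
    | cons b v ihv =>
      rw [msum_sh_cons_cons]
      simp only [msum_spl_cons, msum_add]
      rw [ihu, ihv]
      simp only [msum_spl_cons, msum_add, msum_sh_cons_cons, sh_nil_left, sh_nil_right,
        msum_singleton]
      ring

/-- Singling out a letter of a shuffle. -/
lemma msum_sh_pick (u v : List α) (f : List α × α × List α → ℚ) :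
    msum (sh u v) (fun w => msum (pick w) f) =
      (msum (pick u) fun e => msum (spl v) fun t =>
        msum (sh e.1 t.1) fun p => msum (sh e.2.2 t.2) fun q => f (p, e.2.1, q)) +
      msum (pick v) fun e => msum (spl u) fun t =>
        msum (sh e.1 t.1) fun p => msum (sh e.2.2 t.2) fun q => f (p, e.2.1, q) := by
  induction u generalizing v f with
  | nil => simp
  | cons a u ihu =>
    induction v generalizing f with
    | nil => simp
    | cons b v ihv =>
      rw [msum_sh_cons_cons]
      simp only [msum_pick_cons, msum_add]
      rw [ihu, ihv]
      simp only [msum_pick_cons, msum_spl_cons, msum_add, msum_sh_cons_cons, sh_nil_left,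
        sh_nil_right, msum_singleton]
      rw [sh_comm v (a :: u)]
      ring

/-- Shuffling with a word in which a letter is singled out. -/
lemma msum_sh_append_cons (P Q v : List α) (y : α) (f : List α → ℚ) :
    msum (sh (P ++ y :: Q) v) f =
      msum (spl v) fun t => msum (sh P t.1) fun p => msum (sh Q t.2) fun q => f (p ++ y :: q) := by
  induction P generalizing v f with
  | nil =>
    induction v generalizing f with
    | nil => simp
    | cons b v ihv =>
      simp only [List.nil_append] at ihv ⊢
      rw [msum_sh_cons_cons, ihv]
      simp
  | cons a P ihP =>
    induction v generalizing f with
    | nil => simp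
    | cons b v ihv =>
      simp only [List.cons_append] at ihv ⊢
      rw [msum_sh_cons_cons, ihv, ihP]
      simp only [msum_spl_cons, msum_sh_cons_cons, sh_nil_right, msum_singleton, msum_add,
        List.cons_append]
      ring

/-- Coassociativity of deconcatenation. -/
lemma msum_spl_assoc (w : List α) (f : List α → List α → List α → ℚ) :
    (msum (spl w) fun s => msum (spl s.1) fun t => f t.1 t.2 s.2) =
      msum (spl w) fun s => msum (spl s.2) fun t => f s.1 t.1 t.2 := by
  induction w generalizing f with
  | nil => simp
  | cons a w ih =>
    simp only [msum_spl_cons, msum_spl_nil, msum_add]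
    rw [ih (fun x y z => f (a :: x) y z)]
    ring

lemma msum_spl_fst_nil (w : List α) (f : List α → ℚ) :
    (msum (spl w) fun s => if s.1 = [] then f s.2 else 0) = f w := by
  cases w <;> simp

lemma msum_spl_snd_nil (w : List α) (f : List α → ℚ) :
    (msum (spl w) fun s => if s.2 = [] then f s.1 else 0) = f w := by
  induction w generalizing f with
  | nil => simp
  | cons a w ih => simp [ih (fun x => f (a :: x))]

lemma msum_spl_append_singleton (w : List α) (x : α) (f : List α × List α → ℚ) :
    msum (spl (w ++ [x])) f =
      f (w ++ [x], []) + msum (spl w) (fun s => f (s.1, s.2 ++ [x])) := by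
  induction w generalizing f with
  | nil => simp; ring
  | cons a w ih => simp [ih]; ring

lemma msum_pick_append_singleton (w : List α) (x : α) (f : List α × α × List α → ℚ) :
    msum (pick (w ++ [x])) f =
      f (w, x, []) + msum (pick w) (fun e => f (e.1, e.2.1, e.2.2 ++ [x])) := by
  induction w generalizing f with
  | nil => simp
  | cons a w ih => simp [ih]; ring

lemma append_of_mem_spl {w : List α} {s : List α × List α} (h : s ∈ spl w) :
    s.1 ++ s.2 = w := by
  induction w generalizing s with
  | nil => simp [spl] at h; simp [h]
  | cons a w ih =>
    simp only [spl, Multiset.mem_cons, Multiset.mem_map] at h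
    rcases h with rfl | ⟨t, ht, rfl⟩
    · rfl
    · simp [ih ht]

lemma append_of_mem_pick {w : List α} {e : List α × α × List α} (h : e ∈ pick w) :
    e.1 ++ e.2.1 :: e.2.2 = w := by
  induction w generalizing e with
  | nil => simp [pick] at h
  | cons a w ih =>
    simp only [pick, Multiset.mem_cons, Multiset.mem_map] at h
    rcases h with rfl | ⟨t, ht, rfl⟩
    · rfl
    · simp [ih ht]

lemma msum_spl_eq_pick_snoc (w : List α) (f : List α × List α → ℚ) :
    msum (spl w) f = f ([], w) + msum (pick w) (fun e => f (e.1 ++ [e.2.1], e.2.2)) := by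
  induction w generalizing f with
  | nil => simp
  | cons a w ih => simp [ih]

lemma msum_spl_eq_pick_cons (w : List α) (f : List α × List α → ℚ) :
    msum (spl w) f = f (w, []) + msum (pick w) (fun e => f (e.1, e.2.1 :: e.2.2)) := by
  induction w generalizing f with
  | nil => simp
  | cons a w ih => simp [ih]; ring

/-- A functional on words is alternal if it vanishes on shuffles of nonempty words. -/
def Alt (f : List α → ℚ) : Prop := ∀ u v : List α, u ≠ [] → v ≠ [] → msum (sh u v) f = 0

lemma Alt.msum_sh {f : List α → ℚ} (hf : Alt f) (h0 : f [] = 0) (u v : List α) :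
    msum (sh u v) f = (if u = [] then f v else 0) + (if v = [] then f u else 0) := by
  by_cases hu : u = []
  · subst hu; by_cases hv : v = [] <;> simp [hv, h0]
  · by_cases hv : v = []
    · subst hv; simp [hu]
    · simp [hu, hv, hf u v hu hv]

lemma Alt.sub {f g : List α → ℚ} (hf : Alt f) (hg : Alt g) : Alt (fun w => f w - g w) := by
  intro u v hu hv
  rw [msum_sub, hf u v hu hv, hg u v hu hv, sub_zero]

lemma Alt.add {f g : List α → ℚ} (hf : Alt f) (hg : Alt g) : Alt (fun w => f w + g w) := by
  intro u v hu hv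
  rw [msum_add, hf u v hu hv, hg u v hu hv, add_zero]

lemma Alt.comp_map {f : List β → ℚ} (hf : Alt f) (φ : α → β) : Alt (fun w => f (w.map φ)) := by
  intro u v hu hv
  have := hf (u.map φ) (v.map φ) (by simpa using hu) (by simpa using hv)
  rwa [sh_map, msum_map] at this

/-- The concatenation product of functionals on words. -/
def mulW (A B : List α → ℚ) (w : List α) : ℚ := msum (spl w) fun s => A s.1 * B s.2

lemma alt_mulW_comm {A B : List α → ℚ} (hA : Alt A) (hB : Alt B) (hA0 : A [] = 0)
    (hB0 : B [] = 0) : Alt (fun w => mulW A B w - mulW B A w) := by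
  have key : ∀ {A B : List α → ℚ}, Alt A → Alt B → A [] = 0 → B [] = 0 → ∀ u v : List α,
      u ≠ [] → v ≠ [] → msum (sh u v) (mulW A B) = A u * B v + A v * B u := by
    intro A B hA hB hA0 hB0 u v hu hv
    unfold mulW
    rw [msum_sh_spl u v (fun s => A s.1 * B s.2)]
    simp only [msum_mul_left, msum_mul_right, hA.msum_sh hA0, hB.msum_sh hB0]
    have : ∀ s t : List α × List α,
        ((if s.1 = [] then A t.1 else 0) + (if t.1 = [] then A s.1 else 0)) *
          ((if s.2 = [] then B t.2 else 0) + (if t.2 = [] then B s.2 else 0)) =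
        (if s.1 = [] then B s.2 else 0) * (if t.2 = [] then A t.1 else 0) +
        (if s.2 = [] then A s.1 else 0) * (if t.1 = [] then B t.2 else 0) +
        (if s.1 = [] then (if s.2 = [] then 1 else 0) else 0) * (A t.1 * B t.2) +
        (A s.1 * B s.2) * (if t.1 = [] then (if t.2 = [] then 1 else 0) else 0) := by
      intro s t; split_ifs <;> ring
    simp only [this, msum_add, msum_mul_left, msum_mul_right, msum_spl_fst_nil u B,
      msum_spl_fst_nil v B, msum_spl_snd_nil u A, msum_spl_snd_nil v A,
      msum_spl_fst_nil _ (fun w => if w = [] then (1 : ℚ) else 0), hu, hv, if_false]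
    ring
  intro u v hu hv
  rw [msum_sub, key hA hB hA0 hB0 u v hu hv, key hB hA hB0 hA0 u v hu hv]; ring

end Words

section Flexions

variable {U V : Type*} [AddCommGroup U] [AddCommGroup V]

/-- The sum of the upper entries of a word. -/
def wt (w : List (U × V)) : U := (w.map Prod.fst).sum

omit [AddCommGroup V] in
@[simp] lemma wt_nil : wt ([] : List (U × V)) = 0 := rfl

omit [AddCommGroup V] in
@[simp] lemma wt_cons (x : U × V) (w : List (U × V)) : wt (x :: w) = x.1 + wt w := by simp [wt]

omit [AddCommGroup V] in
@[simp] lemma wt_append (u w : List (U × V)) : wt (u ++ w) = wt u + wt w := by simp [wt]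

omit [AddCommGroup V] in
lemma wt_of_mem_sh {u v w : List (U × V)} (h : w ∈ sh u v) : wt w = wt u + wt v := by
  rw [← wt_append]; exact ((perm_of_mem_sh h).map _).sum_eq

/-- Subtract `c` from all lower entries of a word. -/
def low (c : V) (w : List (U × V)) : List (U × V) := w.map fun y => (y.1, y.2 - c)

omit [AddCommGroup U] in
@[simp] lemma low_nil (c : V) : low c ([] : List (U × V)) = [] := rfl

omit [AddCommGroup U] in
@[simp] lemma low_cons (c : V) (x : U × V) (w : List (U × V)) :
    low c (x :: w) = (x.1, x.2 - c) :: low c w := rfl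

omit [AddCommGroup U] in
@[simp] lemma low_append (c : V) (u w : List (U × V)) : low c (u ++ w) = low c u ++ low c w := by
  simp [low]

@[simp] lemma wt_low (c : V) (w : List (U × V)) : wt (low c w) = wt w := by
  induction w <;> simp_all

omit [AddCommGroup U] in
lemma low_low (c d : V) (w : List (U × V)) : low c (low d w) = low (d + c) w := by
  simp [low, sub_sub]

/-- Add the upper entries of `b` to that of the letter `x`. -/
def absorb (b : List (U × V)) (x : U × V) : U × V := (x.1 + wt b, x.2)

/-- The part of `arit` in which a letter absorbs a factor on its left. -/
def aritL (B A : List (U × V) → ℚ) (w : List (U × V)) : ℚ :=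
  msum (pick w) fun e => msum (spl e.1) fun s =>
    A (s.1 ++ absorb s.2 e.2.1 :: e.2.2) * B (low e.2.1.2 s.2)

/-- The part of `arit` in which a letter absorbs a factor on its right. -/
def aritR (B A : List (U × V) → ℚ) (w : List (U × V)) : ℚ :=
  msum (pick w) fun e => msum (spl e.2.2) fun s =>
    A (e.1 ++ absorb s.1 e.2.1 :: s.2) * B (low e.2.1.2 s.1)

/-- The bracket `ari` on functionals on words. -/
def ariW (A B : List (U × V) → ℚ) (w : List (U × V)) : ℚ :=
  (aritL B A w - aritR B A w) - (aritL A B w - aritR A B w) + (mulW A B w - mulW B A w)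

lemma msum_sh_absorb {B : List (U × V) → ℚ} (hB : Alt B) (hB0 : B [] = 0) (u v : List (U × V))
    (Φ : U → ℚ) (c : V) :
    (msum (sh u v) fun b => Φ (wt b) * B (low c b)) =
      (if u = [] then Φ (wt v) * B (low c v) else 0) +
        (if v = [] then Φ (wt u) * B (low c u) else 0) := by
  have h : (msum (sh u v) fun b => Φ (wt b) * B (low c b)) =
      msum (sh u v) fun b => Φ (wt u + wt v) * B (low c b) :=
    msum_congr fun b hb => by rw [wt_of_mem_sh hb]
  have h' : msum (sh u v) (fun b => B (low c b)) = _ :=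
    (hB.comp_map fun y : U × V => (y.1, y.2 - c)).msum_sh hB0 u v
  rw [h, msum_mul_left, h']
  by_cases hu : u = [] <;> by_cases hv : v = [] <;> simp [hu, hv, low, mul_add]

lemma aux_left {B : List (U × V) → ℚ} (hB : Alt B) (hB0 : B [] = 0)
    (A : List (U × V) → ℚ) (P Q v : List (U × V)) (x : U × V) :
    (msum (spl v) fun t => msum (sh P t.1) fun p => msum (sh Q t.2) fun q =>
      msum (spl p) fun s => A (s.1 ++ absorb s.2 x :: q) * B (low x.2 s.2)) =
    (msum (spl P) fun s => msum (sh (s.1 ++ absorb s.2 x :: Q) v) A * B (low x.2 s.2)) +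
    msum (spl v) fun t => msum (spl t.1) fun r => msum (sh P r.1) fun p => msum (sh Q t.2) fun q =>
      A (p ++ absorb r.2 x :: q) * B (low x.2 r.2) := by
  have h1 : ∀ t : List (U × V) × List (U × V),
      (msum (sh P t.1) fun p => msum (sh Q t.2) fun q =>
        msum (spl p) fun s => A (s.1 ++ absorb s.2 x :: q) * B (low x.2 s.2)) =
      (msum (spl P) fun s => msum (sh s.1 t.1) fun p => msum (sh Q t.2) fun q =>
        A (p ++ absorb s.2 x :: q) * B (low x.2 s.2)) +
      msum (spl t.1) fun r => msum (sh P r.1) fun p => msum (sh Q t.2) fun q =>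
        A (p ++ absorb r.2 x :: q) * B (low x.2 r.2) := by
    intro t
    simp only [msum_comm (sh Q t.2) (spl _)]
    rw [msum_sh_spl P t.1 (fun s => msum (sh Q t.2) fun q =>
      A (s.1 ++ absorb s.2 x :: q) * B (low x.2 s.2))]
    simp only [msum_mul_right]
    set ψ : List (U × V) → List (U × V) → ℚ := fun p b =>
      (msum (sh Q t.2) fun q => A (p ++ absorb b x :: q)) * B (low x.2 b) with hψ
    have h2 : ∀ (s r : List (U × V) × List (U × V)) (p : List (U × V)),
        (msum (sh s.2 r.2) fun b => ψ p b) =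
          (if s.2 = [] then ψ p r.2 else 0) + (if r.2 = [] then ψ p s.2 else 0) :=
      fun s r p => msum_sh_absorb hB hB0 s.2 r.2
        (fun c => msum (sh Q t.2) fun q => A (p ++ (x.1 + c, x.2) :: q)) x.2
    have pull : ∀ (m : Multiset (List (U × V))) (c : Prop) [Decidable c] (g : List (U × V) → ℚ),
        (msum m fun p => if c then g p else 0) = if c then msum m g else 0 := by
      intro m c _ g; split_ifs <;> simp
    have h3 : ∀ r : List (U × V) × List (U × V),
        (msum (spl P) fun s => if s.2 = [] then msum (sh s.1 r.1) (fun p => ψ p r.2) else 0) =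
          msum (sh P r.1) fun p => ψ p r.2 :=
      fun r => msum_spl_snd_nil P fun w => msum (sh w r.1) fun p => ψ p r.2
    have h4 : ∀ s : List (U × V) × List (U × V),
        (msum (spl t.1) fun r => if r.2 = [] then msum (sh s.1 r.1) (fun p => ψ p s.2) else 0) =
          msum (sh s.1 t.1) fun p => ψ p s.2 :=
      fun s => msum_spl_snd_nil t.1 fun w => msum (sh s.1 w) fun p => ψ p s.2
    have h5 : ∀ (s r : List (U × V) × List (U × V)) (p : List (U × V)),
        (msum (sh s.2 r.2) fun b => (msum (sh Q t.2) fun q => A (p ++ absorb b x :: q)) *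
          B (low x.2 b)) = msum (sh s.2 r.2) fun b => ψ p b := fun _ _ _ => rfl
    simp only [h5, h2, msum_add, pull, h4]
    rw [msum_comm (spl P) (spl t.1)]
    simp only [h3]
    rw [add_comm]
    simp only [hψ, msum_mul_right]
  simp only [h1, msum_add]
  congr 1
  rw [msum_comm]
  simp only [msum_sh_append_cons, msum_mul_right]

lemma aux_right {B : List (U × V) → ℚ} (hB : Alt B) (hB0 : B [] = 0)
    (A : List (U × V) → ℚ) (P Q v : List (U × V)) (x : U × V) :
    (msum (spl v) fun t => msum (sh P t.1) fun p => msum (sh Q t.2) fun q =>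
      msum (spl q) fun s => A (p ++ absorb s.1 x :: s.2) * B (low x.2 s.1)) =
    (msum (spl Q) fun s => msum (sh (P ++ absorb s.1 x :: s.2) v) A * B (low x.2 s.1)) +
    msum (spl v) fun t => msum (spl t.2) fun r => msum (sh P t.1) fun p => msum (sh Q r.2) fun q =>
      A (p ++ absorb r.1 x :: q) * B (low x.2 r.1) := by
  have h1 : ∀ (t : List (U × V) × List (U × V)) (p : List (U × V)),
      (msum (sh Q t.2) fun q =>
        msum (spl q) fun s => A (p ++ absorb s.1 x :: s.2) * B (low x.2 s.1)) =
      (msum (spl Q) fun s => msum (sh s.2 t.2) fun q =>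
        A (p ++ absorb s.1 x :: q) * B (low x.2 s.1)) +
      msum (spl t.2) fun r => msum (sh Q r.2) fun q =>
        A (p ++ absorb r.1 x :: q) * B (low x.2 r.1) := by
    intro t p
    rw [msum_sh_spl Q t.2 (fun s => A (p ++ absorb s.1 x :: s.2) * B (low x.2 s.1))]
    simp only [msum_mul_right]
    set ψ : List (U × V) → List (U × V) → List (U × V) → ℚ := fun b c d =>
      (msum (sh c d) fun q => A (p ++ absorb b x :: q)) * B (low x.2 b) with hψ
    have h2 : ∀ s r : List (U × V) × List (U × V),
        (msum (sh s.1 r.1) fun b => ψ b s.2 r.2) =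
          (if s.1 = [] then ψ r.1 s.2 r.2 else 0) + (if r.1 = [] then ψ s.1 s.2 r.2 else 0) :=
      fun s r => msum_sh_absorb hB hB0 s.1 r.1
        (fun c => msum (sh s.2 r.2) fun q => A (p ++ (x.1 + c, x.2) :: q)) x.2
    have h3 : ∀ r : List (U × V) × List (U × V),
        (msum (spl Q) fun s => if s.1 = [] then ψ r.1 s.2 r.2 else 0) = ψ r.1 Q r.2 :=
      fun r => msum_spl_fst_nil Q fun w => ψ r.1 w r.2
    have h4 : ∀ s : List (U × V) × List (U × V),
        (msum (spl t.2) fun r => if r.1 = [] then ψ s.1 s.2 r.2 else 0) = ψ s.1 s.2 t.2 :=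
      fun s => msum_spl_fst_nil t.2 fun w => ψ s.1 s.2 w
    have h5 : ∀ s r : List (U × V) × List (U × V),
        (msum (sh s.1 r.1) fun b => (msum (sh s.2 r.2) fun q => A (p ++ absorb b x :: q)) *
          B (low x.2 b)) = msum (sh s.1 r.1) fun b => ψ b s.2 r.2 := fun _ _ => rfl
    simp only [h5, h2, msum_add, h4]
    rw [msum_comm (spl Q) (spl t.2)]
    simp only [h3]
    rw [add_comm]
  simp only [h1, msum_add]
  congr 1
  · simp only [msum_comm (sh P _) (spl Q)]
    rw [msum_comm]
    simp only [msum_sh_append_cons, msum_mul_right]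
  · simp only [msum_comm (sh P _) (spl _)]

lemma alt_arit {A B : List (U × V) → ℚ} (hA : Alt A) (hB : Alt B) (hB0 : B [] = 0) :
    Alt (fun w => aritL B A w - aritR B A w) := by
  have half : ∀ u v : List (U × V), v ≠ [] →
      (msum (pick u) fun e => msum (spl v) fun t => msum (sh e.1 t.1) fun p =>
        msum (sh e.2.2 t.2) fun q => msum (spl p) fun s =>
          A (s.1 ++ absorb s.2 e.2.1 :: q) * B (low e.2.1.2 s.2)) =
      (msum (pick u) fun e => msum (spl v) fun t => msum (sh e.1 t.1) fun p =>
        msum (sh e.2.2 t.2) fun q => msum (spl q) fun s =>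
          A (p ++ absorb s.1 e.2.1 :: s.2) * B (low e.2.1.2 s.1)) := by
    intro u v hv
    refine msum_congr fun e _ => ?_
    rw [aux_left hB hB0, aux_right hB hB0]
    have hz : ∀ (P Q : List (U × V)) (y : U × V), msum (sh (P ++ y :: Q) v) A = 0 :=
      fun P Q y => hA _ _ (by simp) hv
    simp only [hz, zero_mul, msum_zero_fun, zero_add]
    exact msum_spl_assoc v (fun v1 b v2 => msum (sh e.1 v1) fun p => msum (sh e.2.2 v2) fun q =>
      A (p ++ absorb b e.2.1 :: q) * B (low e.2.1.2 b))
  intro u v hu hv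
  rw [msum_sub, sub_eq_zero]
  unfold aritL aritR
  rw [msum_sh_pick, msum_sh_pick u v, half u v hv, half v u hu]

lemma alt_ariW {A B : List (U × V) → ℚ} (hA : Alt A) (hB : Alt B) (hA0 : A [] = 0)
    (hB0 : B [] = 0) : Alt (ariW A B) :=
  ((alt_arit hA hB hB0).sub (alt_arit hB hA hA0)).add (alt_mulW_comm hA hB hA0 hB0)

end Flexions

section Swap

variable {U V : Type*} [AddCommGroup U] [AddCommGroup V]

/-- The lower entry of the first letter of a word, or `t` if the word is empty. -/
def headLow (t : V) : List (U × V) → V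
  | [] => t
  | y :: _ => y.2

/-- The change of variables underlying `swap`: partial sums of upper entries, starting at `s`,
and differences of consecutive lower entries, ending with `t`, in the reverse order. -/
def swapW (s : U) (t : V) : List (U × V) → List (V × U)
  | [] => []
  | x :: w => swapW (s + x.1) t w ++ [(x.2 - headLow t w, s + x.1)]

omit [AddCommGroup U] [AddCommGroup V] in
@[simp] lemma headLow_nil (t : V) : headLow t ([] : List (U × V)) = t := rfl

omit [AddCommGroup U] [AddCommGroup V] in
@[simp] lemma headLow_cons (t : V) (x : U × V) (w : List (U × V)) :
    headLow t (x :: w) = x.2 := rfl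

omit [AddCommGroup U] [AddCommGroup V] in
@[simp] lemma headLow_append (t : V) (a b : List (U × V)) :
    headLow t (a ++ b) = headLow (headLow t b) a := by cases a <;> simp

@[simp] lemma swapW_nil (s : U) (t : V) : swapW s t [] = [] := rfl

lemma swapW_cons (s : U) (t : V) (x : U × V) (w : List (U × V)) :
    swapW s t (x :: w) = swapW (s + x.1) t w ++ [(x.2 - headLow t w, s + x.1)] := rfl

lemma swapW_append (s : U) (t : V) (a b : List (U × V)) :
    swapW s t (a ++ b) = swapW (s + wt a) t b ++ swapW s (headLow t b) a := by
  induction a generalizing s with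
  | nil => simp
  | cons x a ih => simp [swapW_cons, ih, add_assoc]

@[simp] lemma wt_swapW (s : U) (t : V) (w : List (U × V)) :
    wt (swapW s t w) = headLow t w - t := by
  induction w generalizing s with
  | nil => simp
  | cons x w ih => simp [swapW_cons, ih]

lemma low_swapW (s c : U) (t : V) (w : List (U × V)) :
    low c (swapW s t w) = swapW (s - c) t w := by
  induction w generalizing s with
  | nil => simp
  | cons x w ih => simp [swapW_cons, ih, sub_add_eq_add_sub]

omit [AddCommGroup U] in
lemma headLow_low (t c : V) (w : List (U × V)) :
    headLow t (low c w) = headLow (t + c) w - c := by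
  cases w <;> simp

lemma swapW_low (s : U) (c t : V) (w : List (U × V)) :
    swapW s t (low c w) = swapW s (t + c) w := by
  induction w generalizing s with
  | nil => simp
  | cons x w ih => simp [swapW_cons, ih, headLow_low]

lemma swapW_swapW (s : U) (t : V) (w : List (U × V)) : swapW t s (swapW s t w) = w := by
  induction w generalizing s with
  | nil => simp
  | cons x w ih => simp [swapW_cons, swapW_append, ih]

lemma swapW_eq_nil (s : U) (t : V) (w : List (U × V)) : swapW s t w = [] ↔ w = [] := by
  cases w <;> simp [swapW_cons]

lemma swapW_length (s : U) (t : V) (w : List (U × V)) : (swapW s t w).length = w.length := by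
  induction w generalizing s with
  | nil => simp
  | cons x w ih => simp [swapW_cons, ih]

lemma reverse_swapW_reverse_swapW (p : V) (q s : U) (t : V) (x : U × V) (w : List (U × V)) :
    (swapW p q (swapW s t (x :: w)).reverse).reverse =
      w.map (fun y => (-y.1, p + x.2 - y.2)) ++ [(s + x.1 + wt w - q, p + x.2 - t)] := by
  induction w generalizing x p s with
  | nil => simp [swapW_cons, add_sub_assoc]
  | cons y w ih =>
    rw [swapW_cons, List.reverse_append, List.reverse_singleton, List.singleton_append,
      swapW_cons, List.reverse_append, List.reverse_singleton, List.singleton_append]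
    have := ih (p + (x.2 - headLow t (y :: w))) (s + x.1) y
    have h : p + (x.2 - headLow t (y :: w)) + y.2 = p + x.2 := by simp [add_assoc]
    rw [h] at this
    rw [this]
    simp [swapW_cons, add_assoc]
    exact (add_sub_assoc _ _ _).symm

lemma msum_spl_swapW (s : U) (t : V) (w : List (U × V))
    (f : List (V × U) × List (V × U) → ℚ) :
    msum (spl (swapW s t w)) f =
      msum (spl w) fun e => f (swapW (s + wt e.1) t e.2, swapW s (headLow t e.2) e.1) := by
  induction w generalizing s f with
  | nil => simp
  | cons x w ih =>
    rw [swapW_cons, msum_spl_append_singleton, ih]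
    simp only [msum_spl_cons, wt_nil, add_zero, swapW_nil, swapW_cons, wt_cons, add_assoc]
    congr 1
    refine msum_congr fun e he => ?_
    rw [← append_of_mem_spl he, headLow_append]

lemma msum_pick_swapW (s : U) (t : V) (w : List (U × V))
    (f : List (V × U) × (V × U) × List (V × U) → ℚ) :
    msum (pick (swapW s t w)) f =
      msum (pick w) fun e => f (swapW (s + wt e.1 + e.2.1.1) t e.2.2,
        (e.2.1.2 - headLow t e.2.2, s + wt e.1 + e.2.1.1), swapW s e.2.1.2 e.1) := by
  induction w generalizing s f with
  | nil => simp
  | cons x w ih =>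
    rw [swapW_cons, msum_pick_append_singleton, ih]
    simp only [msum_pick_cons, wt_nil, zero_add, swapW_nil, swapW_cons, wt_cons, add_assoc]
    congr 1
    refine msum_congr fun e he => ?_
    rw [← append_of_mem_pick he, headLow_append, headLow_cons]

/-- The swap of a functional on words. -/
def swapF (f : List (U × V) → ℚ) (w : List (V × U)) : ℚ := f (swapW 0 0 w)

/-- Negate all entries of a word. -/
def negW (w : List (U × V)) : List (U × V) := w.map fun y => -y

/-- The inverse of the `push` on words. -/
def pullW : List (U × V) → List (U × V)
  | [] => []
  | x :: w => low x.2 w ++ [(-(x.1 + wt w), -x.2)]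

end Swap

section Antipode

variable {α : Type*}

/-- The alternating sum of the shuffles of `w_i … w_1 r` with `w_{i+1} … w_m`. -/
def revSum (f : List α → ℚ) (r : List α) : List α → ℚ
  | [] => f r
  | a :: w => msum (sh r (a :: w)) f - revSum f (a :: r) w

lemma revSum_cons (f : List α → ℚ) (b : α) (r w : List α) :
    revSum f (b :: r) w = msum (sh r w) (fun x => f (b :: x)) := by
  induction w generalizing b r with
  | nil => simp [revSum]
  | cons a w ih => rw [revSum, ih, msum_sh_cons_cons]; ring

lemma Alt.revSum_eq {f : List α → ℚ} (hf : Alt f) (r w : List α) (hr : r ≠ []) :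
    revSum f r w = (-1) ^ w.length * f (w.reverse ++ r) := by
  induction w generalizing r with
  | nil => simp [revSum]
  | cons a w ih => rw [revSum, hf _ _ hr (by simp), ih _ (by simp)]; simp [pow_succ]

/-- Alternal functionals are invariant under reversal of words, up to the expected sign. -/
lemma Alt.reverse {f : List α → ℚ} (hf : Alt f) {w : List α} (hw : w ≠ []) :
    f w.reverse = (-1) ^ (w.length + 1) * f w := by
  obtain ⟨a, w, rfl⟩ := List.exists_cons_of_ne_nil hw
  have h1 : revSum f [] (a :: w) = 0 := by
    rw [revSum, revSum_cons]; simp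
  rw [revSum, hf.revSum_eq _ _ (by simp)] at h1
  simp only [sh_nil_left, msum_singleton] at h1
  have h2 : f (a :: w) = (-1) ^ w.length * f (w.reverse ++ [a]) := by linarith
  rw [h2, List.reverse_cons, List.length_cons, ← mul_assoc, ← pow_add,
    Even.neg_one_pow ⟨w.length + 1, by ring⟩, one_mul]

end Antipode

section Push

variable {U V : Type*} [AddCommGroup U] [AddCommGroup V]

@[simp] lemma negW_cons (x : U × V) (w : List (U × V)) : negW (x :: w) = -x :: negW w := rfl

@[simp] lemma negW_nil : negW ([] : List (U × V)) = [] := rfl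

@[simp] lemma negW_append (u w : List (U × V)) : negW (u ++ w) = negW u ++ negW w := by
  simp [negW]

@[simp] lemma negW_negW (w : List (U × V)) : negW (negW w) = w := by
  simp [negW]

@[simp] lemma wt_negW (w : List (U × V)) : wt (negW w) = - wt w := by
  induction w with
  | nil => simp
  | cons x w ih => simp [ih, add_comm]

lemma low_negW (c : V) (w : List (U × V)) : low (-c) (negW w) = negW (low c w) := by
  simp [low, negW, add_comm, sub_eq_add_neg]

lemma pullW_cons (x : U × V) (w : List (U × V)) :
    pullW (x :: w) = low x.2 w ++ [(-(x.1 + wt w), -x.2)] := rfl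

lemma pullW_negW (w : List (U × V)) : pullW (negW w) = negW (pullW w) := by
  cases w with
  | nil => rfl
  | cons x w => simp [pullW_cons, low_negW, add_comm]

/-- A bialternal functional is invariant under the composition of `push` and negation. -/
lemma Alt.negW_pullW {f : List (U × V) → ℚ} (hf : Alt f) (hs : Alt (swapF f))
    (w : List (U × V)) : f (negW (pullW w)) = f w := by
  cases w with
  | nil => rfl
  | cons x w =>
    set W := swapW (0 : U) (0 : V) (x :: w) with hW
    have hW0 : W ≠ [] := by rw [hW, Ne, swapW_eq_nil]; simp
    have h1 := hs.reverse hW0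
    have h2 : swapW (0 : V) (0 : U) W.reverse ≠ [] := by rw [Ne, swapW_eq_nil]; simpa using hW0
    have h3 := hf.reverse h2
    rw [hW, reverse_swapW_reverse_swapW, ← hW, swapW_length, List.length_reverse] at h3
    simp only [swapF] at h1
    rw [h1, ← mul_assoc, ← pow_add, Even.neg_one_pow ⟨_, rfl⟩, one_mul, hW, swapW_swapW] at h3
    rw [← h3, pullW_cons]
    simp [negW, low, Function.comp_def]

lemma msum_sh_singleton_append_singleton {α : Type*} (y e : α) (c : List α) (f : List α → ℚ) :
    msum (sh [y] (c ++ [e])) f = msum (sh [y] c) (fun w => f (w ++ [e])) + f (c ++ [e, y]) := by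
  induction c generalizing f with
  | nil => simp [sh_cons_cons]
  | cons a c ih =>
    rw [List.cons_append, msum_sh_cons_cons, ih, msum_sh_cons_cons]
    simp; ring

/-- An alternal functional that changes sign under `push` vanishes in depth at least two. -/
lemma Alt.eq_zero_of_pullW_neg {N : List (U × V) → ℚ} (hN : Alt N)
    (hp : ∀ w, N (pullW w) = - N w) (y c₁ : U × V) (c : List (U × V)) :
    N (y :: c₁ :: c) = 0 := by
  have h1 : N (y :: c₁ :: c) + msum (sh [y] c) (fun w => N (c₁ :: w)) = 0 := by
    have := hN [y] (c₁ :: c) (by simp) (by simp)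
    rw [msum_sh_cons_cons] at this
    simpa using this
  set e : U × V := (-(c₁.1 + (y.1 + wt c)), -c₁.2) with he
  set y' : U × V := (y.1, y.2 - c₁.2) with hy'
  have h2 : msum (sh [y] c) (fun w => N (c₁ :: w)) =
      - msum (sh [y] c) (fun w => N (low c₁.2 w ++ [e])) := by
    rw [← msum_neg]
    refine msum_congr fun w hw => ?_
    have hwt := wt_of_mem_sh hw
    simp only [wt_cons, wt_nil, add_zero] at hwt
    rw [← neg_neg (N (c₁ :: w)), ← hp, pullW_cons, hwt]
  have h3 : msum (sh [y] c) (fun w => N (low c₁.2 w ++ [e])) + N (low c₁.2 c ++ [e, y']) = 0 := by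
    have := hN [y'] (low c₁.2 c ++ [e]) (by simp) (by simp)
    rw [msum_sh_singleton_append_singleton] at this
    have hs : sh [y'] (low c₁.2 c) = (sh [y] c).map (low c₁.2) :=
      sh_map (fun z : U × V => (z.1, z.2 - c₁.2)) [y] c
    rwa [hs, msum_map] at this
  have h4 : pullW (pullW (y :: c₁ :: c)) = low c₁.2 c ++ [e, y'] := by
    simp only [pullW_cons, low_cons, List.cons_append, low_append, low_low, wt_append, wt_low,
      wt_cons, wt_nil, low_nil, List.append_assoc, List.nil_append, he, hy']
    simp only [add_sub_cancel, List.append_cancel_left_eq, List.cons.injEq, Prod.mk.injEq, and_true]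
    refine ⟨⟨?_, ?_⟩, ?_, ?_⟩ <;> abel
  have h5 := hp (pullW (y :: c₁ :: c))
  rw [h4, hp] at h5
  linarith

lemma Alt.negW {f : List (U × V) → ℚ} (hf : Alt f) (hs : Alt (swapF f))
    (h1 : ∀ x, f [x] = f [-x]) (w : List (U × V)) : f (negW w) = f w := by
  rcases w with _ | ⟨y, _ | ⟨c₁, c⟩⟩
  · rfl
  · exact (h1 y).symm
  · have hN : Alt (fun w => f w - f (KVMould.negW w)) := hf.sub (hf.comp_map _)
    have := hN.eq_zero_of_pullW_neg (fun w => ?_) y c₁ c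
    · linarith
    · have h2 := hf.negW_pullW hs w
      have h3 := hf.negW_pullW hs (KVMould.negW w)
      rw [pullW_negW, negW_negW] at h3
      rw [h2, h3]; ring

/-- A bialternal functional, even in depth one, is `push`-invariant. -/
lemma Alt.pullW {f : List (U × V) → ℚ} (hf : Alt f) (hs : Alt (swapF f))
    (h1 : ∀ x, f [x] = f [-x]) (w : List (U × V)) : f (pullW w) = f w := by
  rw [← hf.negW hs h1, hf.negW_pullW hs]

/-- The functional `preari`. -/
def preariW (A B : List (U × V) → ℚ) (w : List (U × V)) : ℚ :=
  aritL B A w - aritR B A w + mulW A B w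

lemma ariW_eq (A B : List (U × V) → ℚ) (w : List (U × V)) :
    ariW A B w = preariW A B w - preariW B A w := by
  simp only [ariW, preariW]; ring

lemma msum_triple_snoc {α : Type*} (w : List α) (F : List α → List α → List α → ℚ)
    (h0 : ∀ p q, F p [] q = 0) :
    (msum (pick w) fun e => msum (spl e.1) fun s => F s.1 (s.2 ++ [e.2.1]) e.2.2) =
      msum (spl w) fun s => msum (spl s.1) fun t => F t.1 t.2 s.2 := by
  rw [msum_spl_eq_pick_snoc w]
  simp [msum_spl_append_singleton, h0]

lemma msum_triple_cons {α : Type*} (w : List α) (F : List α → List α → List α → ℚ)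
    (h0 : ∀ p q, F p [] q = 0) :
    (msum (pick w) fun e => msum (spl e.2.2) fun s => F e.1 (e.2.1 :: s.1) s.2) =
      msum (spl w) fun s => msum (spl s.2) fun t => F s.1 t.1 t.2 := by
  rw [msum_spl_eq_pick_cons w]
  simp [h0]

lemma swapF_aritR {A B : List (U × V) → ℚ} (hB0 : B [] = 0) (hp : ∀ w, B (pullW w) = B w)
    (w : List (V × U)) :
    swapF (aritR B A) w = aritR (swapF B) (swapF A) w := by
  let F : List (V × U) → List (V × U) → List (V × U) → ℚ := fun p m q =>
    match m with
    | [] => 0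
    | y :: b => swapF A (p ++ absorb b y :: q) * swapF B (low y.2 b)
  have hR : aritR (swapF B) (swapF A) w = msum (pick w) fun e => msum (spl e.2.2) fun s =>
    F e.1 (e.2.1 :: s.1) s.2 := rfl
  rw [hR, msum_triple_cons w F (fun _ _ => rfl), ← msum_spl_assoc,
    ← msum_triple_snoc w F (fun _ _ => rfl)]
  unfold swapF aritR
  rw [msum_pick_swapW]
  refine msum_congr fun e he => ?_
  rw [msum_spl_swapW]
  refine msum_congr fun s hs => ?_
  obtain ⟨P, x, Q⟩ := e
  obtain ⟨p, b⟩ := s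
  have hP : p ++ b = P := append_of_mem_spl hs
  subst hP
  simp only [low_swapW]
  rcases b with _ | ⟨y, c⟩
  · simp [F, hB0, swapF]
  · simp [F, swapF, swapW_append, swapW_cons, absorb, swapW_low]
    congr 1
    · simp only [← add_assoc]
    · rw [← hp (_ :: _), pullW_cons, low_swapW, wt_swapW]
      congr! 3 <;> simp <;> abel

lemma swapF_aritL_add_mulW {A B : List (U × V) → ℚ} (hA0 : A [] = 0) (w : List (V × U)) :
    aritL B A (swapW 0 0 w) + mulW A B (swapW 0 0 w) =
      aritL (swapF B) (swapF A) w + mulW (swapF A) (swapF B) w := by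
  let H : List (V × U) → List (V × U) → List (V × U) → ℚ := fun p b q =>
    match q with
    | [] => swapF A p * swapF B b
    | y :: q => swapF A (p ++ absorb b y :: q) * swapF B (low y.2 b)
  have hR : aritL (swapF B) (swapF A) w + mulW (swapF A) (swapF B) w =
      msum (spl w) fun s => msum (spl s.1) fun t => H t.1 t.2 s.2 := by
    rw [msum_spl_eq_pick_cons w, add_comm]; rfl
  rw [hR, msum_spl_assoc, msum_spl_eq_pick_snoc w, add_comm]
  unfold aritL mulW
  rw [msum_pick_swapW, msum_spl_swapW]
  congr 1
  · refine msum_congr fun s hs => ?_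
    obtain ⟨b, q⟩ := s
    rcases q with _ | ⟨y, q⟩
    · simp [H, swapF, hA0]
    · simp [H, swapF, swapW_append, swapW_cons, absorb, swapW_low, add_comm (wt b)]
  · refine msum_congr fun e he => ?_
    rw [msum_spl_swapW]
    refine msum_congr fun s hs => ?_
    obtain ⟨P, x, Q⟩ := e
    obtain ⟨b, q⟩ := s
    have hP : b ++ q = Q := append_of_mem_spl hs
    subst hP
    rcases q with _ | ⟨y, q⟩
    · simp [H, swapF, swapW_append, swapW_cons, absorb, low_swapW, swapW_low]
    · simp [H, swapF, swapW_append, swapW_cons, absorb, low_swapW, swapW_low, ← add_assoc,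
        add_right_comm _ y.1]

lemma swapF_preariW {A B : List (U × V) → ℚ} (hA0 : A [] = 0) (hB0 : B [] = 0)
    (hp : ∀ w, B (pullW w) = B w) (w : List (V × U)) :
    swapF (preariW A B) w = preariW (swapF A) (swapF B) w := by
  have h1 := swapF_aritL_add_mulW (A := A) (B := B) hA0 w
  have h2 := swapF_aritR (A := A) hB0 hp w
  simp only [preariW, swapF] at *
  linarith

/-- The bracket of two bialternal functionals is bialternal. -/
lemma alt_swapF_ariW {A B : List (U × V) → ℚ} (hA : Alt A) (hB : Alt B)
    (hsA : Alt (swapF A)) (hsB : Alt (swapF B)) (hA0 : A [] = 0) (hB0 : B [] = 0)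
    (hA1 : ∀ x, A [x] = A [-x]) (hB1 : ∀ x, B [x] = B [-x]) : Alt (swapF (ariW A B)) := by
  have h : swapF (ariW A B) = ariW (swapF A) (swapF B) := by
    funext w
    rw [ariW_eq, ← swapF_preariW hA0 hB0 (hB.pullW hsB hB1),
      ← swapF_preariW hB0 hA0 (hA.pullW hsA hA1)]
    exact ariW_eq A B _
  rw [h]
  exact alt_ariW hsA hsB (by simpa [swapF] using hA0) (by simpa [swapF] using hB0)

end Push

section ShuffleSum

variable {α : Type*}

lemma mem_sh_iff_filter (P : α → Bool) (w u v : List α) (hu : ∀ a ∈ u, P a = true)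
    (hv : ∀ a ∈ v, P a = false) :
    w ∈ sh u v ↔ w.filter P = u ∧ w.filter (fun a => !P a) = v := by
  induction w generalizing u v with
  | nil =>
    rcases u with _ | ⟨a, u⟩ <;> rcases v with _ | ⟨b, v⟩ <;> simp [sh_cons_cons]
  | cons c w ih =>
    rcases u with _ | ⟨a, u⟩
    · rw [sh_nil_left, Multiset.mem_singleton]
      constructor
      · rintro rfl
        exact ⟨by simpa [List.filter_eq_nil_iff] using hv,
          List.filter_eq_self.2 fun a ha => by simp [hv a ha]⟩
      · rintro ⟨h1, h2⟩
        rw [← h2, eq_comm, List.filter_eq_self]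
        intro a ha
        simpa using List.filter_eq_nil_iff.1 h1 a ha
    rcases v with _ | ⟨b, v⟩
    · rw [sh_nil_right, Multiset.mem_singleton]
      constructor
      · rintro h
        rw [← h] at hu ⊢
        exact ⟨List.filter_eq_self.2 hu, by simpa [List.filter_eq_nil_iff] using hu⟩
      · rintro ⟨h1, h2⟩
        rw [← h1, eq_comm, List.filter_eq_self]
        intro a ha
        simpa using List.filter_eq_nil_iff.1 h2 a ha
    · have hu' := fun x hx => hu x (List.mem_cons_of_mem a hx)
      have hv' := fun x hx => hv x (List.mem_cons_of_mem b hx)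
      have ha := hu a (by simp)
      have hb := hv b (by simp)
      have ih1 := ih u (b :: v) hu' hv
      have ih2 := ih (a :: u) v hu hv'
      rw [sh_cons_cons]
      cases hc : P c
      · have : c ≠ a := by rintro rfl; simp [ha] at hc
        simp [hc, ih2, this.symm]
        tauto
      · have : c ≠ b := by rintro rfl; simp [hb] at hc
        simp [hc, ih1, this.symm]
        tauto

lemma nodup_sh (P : α → Bool) (u v : List α) (hu : ∀ a ∈ u, P a = true)
    (hv : ∀ a ∈ v, P a = false) : (sh u v).Nodup := by
  induction u generalizing v with
  | nil => simp
  | cons a u ihu =>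
    induction v with
    | nil => simp
    | cons b v ihv =>
      have hu' := fun x hx => hu x (List.mem_cons_of_mem a hx)
      have hv' := fun x hx => hv x (List.mem_cons_of_mem b hx)
      rw [sh_cons_cons, Multiset.nodup_add]
      refine ⟨(ihu _ hu' hv).map List.cons_injective, (ihv hv').map List.cons_injective, ?_⟩
      rw [Multiset.disjoint_left]
      intro w h1 h2
      simp only [Multiset.mem_map] at h1 h2
      obtain ⟨x, -, rfl⟩ := h1
      obtain ⟨y, -, h⟩ := h2
      have ha := hu a (by simp)
      have hb := hv b (by simp)
      rw [← (List.cons.inj h).1, hb] at ha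
      cases ha

lemma mem_shuffles_iff_filter (p q : ℕ) (τ : Equiv.Perm (Fin (p + q))) :
    τ ∈ shuffles p q ↔
      (List.ofFn τ).filter (fun i => i.val < p) = (List.finRange (p + q)).filter (fun i => i.val < p) ∧
      (List.ofFn τ).filter (fun i => !decide (i.val < p)) =
        (List.finRange (p + q)).filter (fun i => !decide (i.val < p)) := by
  have hperm : (List.ofFn τ).Perm (List.finRange (p + q)) := by
    simpa [List.ofFn_id] using Equiv.Perm.ofFn_comp_perm τ id
  have key : ∀ R : Fin (p + q) → Bool,
      (List.ofFn τ).filter R = (List.finRange (p + q)).filter R ↔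
        ∀ i j : Fin (p + q), i < j → R i = true → R j = true → τ⁻¹ i < τ⁻¹ j := by
    intro R
    have hs : ((List.finRange (p + q)).filter R).Pairwise (· < ·) :=
      (List.pairwise_lt_finRange _).filter _
    have h1 : (List.ofFn τ).filter R = (List.finRange (p + q)).filter R ↔
        ((List.ofFn τ).filter R).Pairwise (· < ·) :=
      ⟨fun h => h ▸ hs, fun h => List.Perm.eq_of_pairwise
        (fun a b _ _ h1 h2 => absurd h1 h2.asymm) h hs (hperm.filter _)⟩
    rw [h1, List.pairwise_filter, List.pairwise_ofFn]
    constructor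
    · intro h i j hij hi hj
      by_contra hn
      rcases (not_lt.1 hn).lt_or_eq with hlt | heq
      · have := h hlt (by simpa using hj) (by simpa using hi)
        simp only [Equiv.Perm.inv_def, Equiv.apply_symm_apply] at this
        exact absurd this hij.asymm
      · exact hij.ne' (τ⁻¹.injective heq)
    · intro h i j hij hi hj
      by_contra hn
      rcases (not_lt.1 hn).lt_or_eq with hlt | heq
      · have := h _ _ hlt hj hi
        simp only [Equiv.Perm.inv_def, Equiv.symm_apply_apply] at this
        exact absurd this hij.asymm
      · exact hij.ne' (τ.injective heq)
  rw [key, key]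
  simp only [shuffles, Finset.mem_filter, Finset.mem_univ, true_and, decide_eq_true_eq,
    Bool.not_eq_true', decide_eq_false_iff_not, not_lt]
  refine and_congr ?_ ?_
  · exact forall₂_congr fun i j => ⟨fun h hij _ hj => h hij hj, fun h hij hj => h hij (hij.trans hj) hj⟩
  · exact forall₂_congr fun i j =>
      ⟨fun h hij hi _ => h hij hi, fun h hij hi => h hij hi (hi.trans (Fin.lt_def.1 hij).le)⟩

lemma sum_shuffles {p q : ℕ} (z : Fin (p + q) → α) (f : List α → ℚ) :
    ∑ τ ∈ shuffles p q, f (List.ofFn fun i => z (τ i)) =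
      msum (sh (List.ofFn fun i => z (Fin.castAdd q i)) (List.ofFn fun j => z (Fin.natAdd p j))) f := by
  set R : Fin (p + q) → Bool := fun i => i.val < p with hR
  set u : List (Fin (p + q)) := List.ofFn fun i => Fin.castAdd q i with hu
  set v : List (Fin (p + q)) := List.ofFn fun j => Fin.natAdd p j with hv
  have hRu : ∀ a ∈ u, R a = true := by simp [hu, hR, List.mem_ofFn]
  have hRv : ∀ a ∈ v, R a = false := by simp [hv, hR, List.mem_ofFn]
  have hfin : List.finRange (p + q) = u ++ v := by
    rw [← List.ofFn_id, List.ofFn_add]; rfl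
  have hfu : (List.finRange (p + q)).filter R = u := by
    rw [hfin, List.filter_append, List.filter_eq_self.2 hRu, List.filter_eq_nil_iff.2, List.append_nil]
    exact fun a ha => by simp [hRv a ha]
  have hfv : (List.finRange (p + q)).filter (fun a => !R a) = v := by
    rw [hfin, List.filter_append, List.filter_eq_nil_iff.2,
      List.filter_eq_self.2, List.nil_append]
    · exact fun a ha => by simp [hRv a ha]
    · exact fun a ha => by simp [hRu a ha]
  have hsh : (shuffles p q).val.map (fun τ : Equiv.Perm (Fin (p + q)) => List.ofFn τ) = sh u v := by
    rw [Multiset.Nodup.ext ((shuffles p q).nodup.map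
      fun a b h => Equiv.coe_fn_injective (List.ofFn_injective h)) (nodup_sh R u v hRu hRv)]
    intro w
    rw [mem_sh_iff_filter R w u v hRu hRv, Multiset.mem_map]
    constructor
    · rintro ⟨τ, hτ, rfl⟩
      have := (mem_shuffles_iff_filter p q τ).1 hτ
      rwa [hfu, hfv] at this
    · intro h
      have hw : w.Perm (List.finRange (p + q)) := by
        rw [hfin, ← h.1, ← h.2]
        exact (List.filter_append_perm R w).symm
      have hlen : w.length = p + q := by simpa using hw.length_eq
      obtain ⟨g, rfl⟩ : ∃ g : Fin (p + q) → Fin (p + q), List.ofFn g = w :=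
        ⟨fun i => w.get (i.cast hlen.symm), by
          apply List.ext_getElem <;> simp [hlen]⟩
      have hg : Function.Injective g := List.nodup_ofFn.1 (hw.nodup_iff.2 (List.nodup_finRange _))
      refine ⟨Equiv.ofBijective g (Finite.injective_iff_bijective.1 hg), ?_, rfl⟩
      refine (mem_shuffles_iff_filter p q _).2 ?_
      rw [show (List.finRange (p + q)).filter (fun i => decide (i.val < p)) = u from hfu,
        show (List.finRange (p + q)).filter (fun i => !decide (i.val < p)) = v from hfv]
      exact h
  have h2 : sh (List.ofFn fun i => z (Fin.castAdd q i)) (List.ofFn fun j => z (Fin.natAdd p j)) =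
      (sh u v).map (List.map z) := by
    rw [← sh_map]
    simp [hu, hv, List.map_ofFn, Function.comp_def]
  rw [h2, ← hsh, msum_map, msum_map]
  simp only [msum, List.map_ofFn]
  rfl

end ShuffleSum

section Sums

variable {α : Type*}

lemma msum_spl_eq_sum (w : List α) (f : List α × List α → ℚ) :
    msum (spl w) f = ∑ k ∈ Finset.range (w.length + 1), f (w.take k, w.drop k) := by
  induction w generalizing f with
  | nil => simp
  | cons a w ih =>
    rw [msum_spl_cons, ih, List.length_cons, Finset.sum_range_succ' _ (w.length + 1)]
    simp [add_comm]

lemma msum_pick_eq_sum (d : α) (w : List α) (f : List α × α × List α → ℚ) :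
    msum (pick w) f = ∑ k ∈ Finset.range w.length, f (w.take k, w.getD k d, w.drop (k + 1)) := by
  induction w generalizing f with
  | nil => simp
  | cons a w ih =>
    rw [msum_pick_cons, ih, List.length_cons, Finset.sum_range_succ', add_comm]
    simp

lemma sum_blocks_left (m : ℕ) (g : ℕ → ℕ → ℚ) :
    (∑ k ∈ Finset.range m, ∑ l ∈ Finset.range m, if k ≤ l ∧ l + 1 < m then g k l else 0) =
      ∑ i ∈ Finset.range m, ∑ j ∈ Finset.range (i + 1), if j < i then g j (i - 1) else 0 := by
  rw [Finset.sum_comm]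
  rcases m with _ | n
  · simp
  refine (Finset.sum_range_succ _ n).trans (Eq.trans ?_ (Finset.sum_range_succ' _ n).symm)
  simp only [lt_irrefl, and_false, if_false, Finset.sum_const_zero, add_zero, not_lt_zero]
  refine Finset.sum_congr rfl fun i hi => ?_
  rw [Finset.mem_range] at hi
  obtain ⟨r, rfl⟩ : ∃ r, n = i + 1 + r := ⟨n - (i + 1), by omega⟩
  rw [Finset.sum_range_succ _ (i + 1), show i + 1 + r + 1 = (i + 1) + (r + 1) by ring,
    Finset.sum_range_add]
  rw [Finset.sum_eq_zero (s := Finset.range (r + 1)) fun a _ => if_neg (by omega)]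
  simp only [lt_irrefl, if_false]
  congr 1
  refine Finset.sum_congr rfl fun j hj => ?_
  rw [Finset.mem_range] at hj
  rw [if_pos (by omega), if_pos hj, Nat.add_sub_cancel]

lemma sum_blocks_right (m : ℕ) (g : ℕ → ℕ → ℚ) :
    (∑ k ∈ Finset.range m, ∑ l ∈ Finset.range m, if 1 ≤ k ∧ k ≤ l then g k l else 0) =
      ∑ i ∈ Finset.range m, ∑ j ∈ Finset.range (m - (i + 1) + 1),
        if 0 < j then g (i + 1) (i + j) else 0 := by
  rcases m with _ | n
  · simp
  refine (Finset.sum_range_succ' _ n).trans (Eq.trans ?_ (Finset.sum_range_succ _ n).symm)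
  simp only [nonpos_iff_eq_zero, one_ne_zero, false_and, if_false, Finset.sum_const_zero, add_zero,
    Nat.sub_self, zero_add, Finset.sum_range_one, lt_irrefl]
  refine Finset.sum_congr rfl fun i hi => ?_
  rw [Finset.mem_range] at hi
  obtain ⟨r, rfl⟩ : ∃ r, n = i + r := ⟨n - i, by omega⟩
  rw [show i + r + 1 = (i + 1) + r by ring, Finset.sum_range_add,
    Finset.sum_eq_zero (s := Finset.range (i + 1)) fun a ha => if_neg (by
      rw [Finset.mem_range] at ha; omega), zero_add, Nat.add_sub_cancel_left,
    Finset.sum_range_succ']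
  simp only [lt_irrefl, if_false, add_zero]
  refine Finset.sum_congr rfl fun j _ => ?_
  rw [if_pos (by omega), if_pos (by omega), add_right_comm, add_assoc]

end Sums

section Eval

/-- A mould as a functional on words in pairs (upper entry, lower entry). -/
def evalM (M : Mould Γ) (w : List (ℚ × Additive Γ)) : ℚ :=
  M w.length (fun i => (w.get i).2.toMul) (fun i => (w.get i).1)

omit [CommGroup Γ] in
lemma evalM_eq (M : Mould Γ) {w : List (ℚ × Additive Γ)} {m : ℕ} (hw : w.length = m)
    {σ : Fin m → Γ} {x : Fin m → ℚ}
    (h : ∀ i : Fin m, w[i.val]? = some (x i, Additive.ofMul (σ i))) : evalM M w = M m σ x := by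
  subst hw
  unfold evalM
  congr 1 <;> funext i <;> have := h i <;> simp only [Fin.is_lt, List.getElem?_eq_getElem,
    Option.some.injEq] at this <;> simp [this]

omit [CommGroup Γ] in
lemma evalM_ofFn (M : Mould Γ) {m : ℕ} (σ : Fin m → Γ) (x : Fin m → ℚ) :
    evalM M (List.ofFn fun i => (x i, Additive.ofMul (σ i))) = M m σ x :=
  evalM_eq M (by simp) fun i => by simp

omit [CommGroup Γ] in
lemma isAlternal_iff (M : Mould Γ) : IsAlternal M ↔ Alt (evalM M) := by
  constructor
  · intro h u v hu hv
    have := h u.length v.length (List.length_pos_iff.2 hu) (List.length_pos_iff.2 hv)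
      (fun i => ((u ++ v)[i.val]'(by simp)).2.toMul) (fun i => ((u ++ v)[i.val]'(by simp)).1)
    simp only [← evalM_ofFn] at this
    have h2 := sum_shuffles (fun i : Fin (u.length + v.length) => (u ++ v)[i.val]'(by simp)) (evalM M)
    have hu' : (List.ofFn fun i : Fin u.length => u[i.val]) = u := List.ofFn_getElem
    have hv' : (List.ofFn fun i : Fin v.length => v[i.val]) = v := List.ofFn_getElem
    simp only [Fin.val_castAdd, Fin.val_natAdd, List.getElem_append_left, Fin.is_lt,
      List.getElem_append_right, Nat.le_add_right, Nat.add_sub_cancel_left, hu', hv'] at h2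
    rw [← h2, ← this]
    rfl
  · intro h p q hp hq σ x
    simp only [← evalM_ofFn]
    rw [sum_shuffles (fun i : Fin (p + q) => (x i, Additive.ofMul (σ i))) (evalM M)]
    refine h _ _ ?_ ?_
    · rw [Ne, List.ofFn_eq_nil_iff]; omega
    · rw [Ne, List.ofFn_eq_nil_iff]; omega

/-- The upper entry at a given position, extended by zero. -/
def upAt {U V : Type*} [Zero U] (w : List (U × V)) (i : ℕ) : U := (w.map Prod.fst).getD i 0

/-- The lower entry at a given position, extended by `t`. -/
def lowAt {U V : Type*} (t : V) (w : List (U × V)) (i : ℕ) : V := (w.map Prod.snd).getD i t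

lemma getElem?_swapW {U V : Type*} [AddCommGroup U] [AddCommGroup V] (s : U) (t : V)
    (w : List (U × V)) (i : ℕ) (hi : i < w.length) :
    (swapW s t w)[i]? = some (lowAt t w (w.length - 1 - i) - lowAt t w (w.length - i),
      s + ∑ j ∈ Finset.range (w.length - i), upAt w j) := by
  induction w generalizing s with
  | nil => simp at hi
  | cons x w ih =>
    rw [swapW_cons, List.length_cons] at *
    rcases (Nat.lt_succ_iff.1 hi).lt_or_eq with h | rfl
    · obtain ⟨r, hr⟩ : ∃ r, w.length = i + 1 + r := ⟨w.length - (i + 1), by omega⟩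
      rw [List.getElem?_append_left (by rwa [swapW_length]), ih _ h, hr,
        show i + 1 + r - 1 - i = r by omega, show i + 1 + r - i = r + 1 by omega,
        show i + 1 + r + 1 - 1 - i = r + 1 by omega, show i + 1 + r + 1 - i = r + 1 + 1 by omega,
        Finset.sum_range_succ' _ (r + 1)]
      simp [lowAt, upAt, add_assoc, add_comm, add_left_comm]
    · rw [List.getElem?_append_right (by rw [swapW_length]), swapW_length]
      simp [lowAt, upAt]
      cases w <;> simp

omit [CommGroup Γ] in
lemma extQ_get {V : Type*} (w : List (ℚ × V)) :
    extQ (fun i : Fin w.length => (w.get i).1) = upAt w := by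
  funext i
  by_cases h : i < w.length <;> simp [extQ, upAt, h]

lemma extG_get {U : Type*} (w : List (U × Additive Γ)) :
    extG (fun i : Fin w.length => (w.get i).2.toMul) = fun i => (lowAt 0 w i).toMul := by
  funext i
  by_cases h : i < w.length <;> simp [extG, lowAt, h]

lemma evalM_swapM (M : Mould Γ) (w : List (Additive Γ × ℚ)) :
    evalM (swapM M) (w.map Prod.swap) = swapF (evalM M) w := by
  symm
  unfold swapF
  conv_rhs => unfold evalM swapM
  rw [extQ_get, extG_get]
  refine evalM_eq M (by simp [swapW_length]) fun i => ?_
  rw [getElem?_swapW _ _ _ _ (by simpa using i.2)]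
  simp [upAt, lowAt, Function.comp_def]

lemma isAlternal_swapM_iff (M : Mould Γ) : IsAlternal (swapM M) ↔ Alt (swapF (evalM M)) := by
  have h : swapF (evalM M) = fun w => evalM (swapM M) (w.map Prod.swap) :=
    funext fun w => (evalM_swapM M w).symm
  rw [isAlternal_iff, h]
  refine ⟨fun h => h.comp_map _, fun h => ?_⟩
  simpa using h.comp_map Prod.swap

lemma evalM_mouldMul (A B : Mould Γ) (w : List (ℚ × Additive Γ)) :
    evalM (mouldMul A B) w = mulW (evalM A) (evalM B) w := by
  rw [mulW, msum_spl_eq_sum]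
  unfold evalM mouldMul
  rw [extQ_get, extG_get]
  refine Finset.sum_congr rfl fun k hk => ?_
  rw [Finset.mem_range] at hk
  congr 1 <;> symm
  · refine evalM_eq A (by simp; omega) fun i => ?_
    have : i.val < w.length := by omega
    simp [upAt, lowAt, this]
  · refine evalM_eq B (by simp) fun i => ?_
    have : k + i.val < w.length := by omega
    simp [upAt, lowAt, this]

end Eval

section Bracket

lemma wt_take {U V : Type*} [AddCommGroup U] (w : List (U × V)) (i : ℕ) :
    wt (w.take i) = ∑ a ∈ Finset.range i, upAt w a := by
  induction w generalizing i with
  | nil => simp [upAt]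
  | cons x w ih =>
    rcases i with _ | i
    · simp
    · rw [List.take_succ_cons, wt_cons, ih, Finset.sum_range_succ', add_comm]
      simp [upAt]

lemma wt_drop_take {U V : Type*} [AddCommGroup U] (w : List (U × V)) {i j : ℕ} (h : i ≤ j) :
    wt ((w.take j).drop i) = ∑ a ∈ Finset.Ico i j, upAt w a := by
  have := congrArg wt (List.take_append_drop i (w.take j))
  rw [wt_append, List.take_take, min_eq_left h, wt_take, wt_take] at this
  rw [Finset.sum_Ico_eq_sub _ h, ← this, add_sub_cancel_left]

lemma evalM_aritU (A B : Mould Γ) (hB : evalM B [] = 0) (w : List (ℚ × Additive Γ)) :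
    evalM (aritU B A) w = aritL (evalM B) (evalM A) w - aritR (evalM B) (evalM A) w := by
  have hget : ∀ i, i < w.length → w[i]? = some (upAt w i, lowAt 0 w i) := fun i hi => by
    simp [upAt, lowAt, hi]
  have hD : ∀ i, i < w.length → w.getD i 0 = (upAt w i, lowAt 0 w i) := fun i hi => by
    simp [upAt, lowAt, hi]
  conv_lhs => unfold evalM aritU
  rw [extQ_get, extG_get]
  congr 1
  · rw [sum_blocks_left, aritL, msum_pick_eq_sum 0]
    refine Finset.sum_congr rfl fun i hi => ?_
    rw [Finset.mem_range] at hi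
    rw [msum_spl_eq_sum, List.length_take, min_eq_left hi.le]
    refine Finset.sum_congr rfl fun j hj => ?_
    rw [Finset.mem_range] at hj
    split_ifs with hji
    · congr 1 <;> symm
      · refine evalM_eq A (by simp; omega) fun a => ?_
        have ha := a.2
        dsimp only
        have hlen : ((w.take i).take j).length = j := by simp; omega
        rcases lt_trichotomy a.val j with h | h | h
        · rw [List.getElem?_append_left (by omega), List.getElem?_take_of_lt h,
            List.getElem?_take_of_lt (by omega), hget _ (by omega), if_pos h, if_pos h]
          rfl
        · rw [List.getElem?_append_right (by omega), hlen, h, Nat.sub_self, hD i hi, absorb,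
            wt_drop_take w hji.le, show i - 1 + 1 = i by omega, ← Finset.sum_Ico_add_eq_sum_Icc hji.le]
          simp [add_comm]
        · obtain ⟨r, hr⟩ : ∃ r, a.val = j + (r + 1) := ⟨a.val - (j + 1), by omega⟩
          rw [List.getElem?_append_right (by omega), hlen, hr, Nat.add_sub_cancel_left,
            List.getElem?_cons_succ, List.getElem?_drop, hget _ (by omega)]
          simp [show i + 1 + r = j + (r + 1) + (i - 1 - j + 1) by omega]
      · refine evalM_eq B (by simp [low]; omega) fun a => ?_
        have ha := a.2
        rw [low, List.getElem?_map, List.getElem?_drop, List.getElem?_take_of_lt (by omega),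
          hget _ (by omega), hD i hi, show i - 1 + 1 = i by omega]
        simp [sub_eq_add_neg]
    · obtain rfl : j = i := by omega
      simp [hB]
  · rw [sum_blocks_right, aritR, msum_pick_eq_sum 0]
    refine Finset.sum_congr rfl fun i hi => ?_
    rw [Finset.mem_range] at hi
    rw [msum_spl_eq_sum, List.length_drop]
    refine Finset.sum_congr rfl fun j hj => ?_
    rw [Finset.mem_range] at hj
    split_ifs with hji
    · congr 1 <;> symm
      · refine evalM_eq A (by simp; omega) fun a => ?_
        have ha := a.2
        dsimp only
        have hlen : (w.take i).length = i := by simp; omega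
        rcases lt_trichotomy a.val i with h | h | h
        · rw [List.getElem?_append_left (by omega), List.getElem?_take_of_lt h,
            hget _ (by omega), Nat.add_sub_cancel, if_pos h, if_pos h]
          rfl
        · rw [List.getElem?_append_right (by omega), hlen, h, Nat.sub_self, hD i hi, absorb,
            List.take_drop, wt_drop_take w (Nat.le_add_right _ _), Nat.add_sub_cancel,
            show Finset.Icc i (i + j) = Finset.Ico i (i + 1 + j) by ext; simp; omega,
            Finset.sum_eq_sum_Ico_succ_bot (a := i) (by omega)]
          simp
        · obtain ⟨r, hr⟩ : ∃ r, a.val = i + (r + 1) := ⟨a.val - (i + 1), by omega⟩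
          rw [List.getElem?_append_right (by omega), hlen, hr, Nat.add_sub_cancel_left,
            List.getElem?_cons_succ, List.getElem?_drop, List.getElem?_drop, hget _ (by omega)]
          simp [show i + 1 + (j + r) = i + (r + 1) + (i + j - (i + 1) + 1) by omega]
      · refine evalM_eq B (by simp [low]; omega) fun a => ?_
        have ha := a.2
        rw [low, List.getElem?_map, List.getElem?_take_of_lt (by omega), List.getElem?_drop,
          hget _ (by omega), hD i hi]
        simp [sub_eq_add_neg]
    · obtain rfl : j = 0 := by omega
      simp [hB]

omit [CommGroup Γ] in
lemma evalM_nil {M : Mould Γ} (hM : IsARI M) : evalM M [] = 0 := hM _ _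

lemma evalM_ariU {A B : Mould Γ} (hA : IsARI A) (hB : IsARI B) :
    evalM (ariU A B) = ariW (evalM A) (evalM B) := by
  funext w
  rw [ariW, ← evalM_aritU A B (evalM_nil hB), ← evalM_aritU B A (evalM_nil hA),
    ← evalM_mouldMul, ← evalM_mouldMul, ← add_sub_assoc]
  rfl

lemma ariW_nil {U V : Type*} [AddCommGroup U] [AddCommGroup V] {A B : List (U × V) → ℚ}
    (hA : A [] = 0) (hB : B [] = 0) : ariW A B [] = 0 := by
  simp [ariW, aritL, aritR, mulW, hA, hB]

lemma ariW_singleton {U V : Type*} [AddCommGroup U] [AddCommGroup V] {A B : List (U × V) → ℚ}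
    (hA : A [] = 0) (hB : B [] = 0) (x : U × V) : ariW A B [x] = 0 := by
  simp [ariW, aritL, aritR, mulW, hA, hB]

lemma evalM_singleton_neg {M : Mould Γ}
    (h : ∀ (σ : Γ) (t : ℚ), M 1 (fun _ => σ) (fun _ => t) = M 1 (fun _ => σ⁻¹) (fun _ => -t))
    (x : ℚ × Additive Γ) : evalM M [x] = evalM M [-x] := by
  have h1 := evalM_ofFn M (fun _ : Fin 1 => x.2.toMul) (fun _ => x.1)
  have h2 := evalM_ofFn M (fun _ : Fin 1 => x.2.toMul⁻¹) (fun _ => -x.1)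
  rw [h, ← h2] at h1
  exact h1

end Bracket

/-- Proposition: the `ari_u`-bracket of bialternal ARI moulds is bialternal
(and again an ARI mould); hence `ARI(Γ)_{al/al}` is a Lie subalgebra. -/
theorem ariU_bialternal (Γ : Type) [CommGroup Γ] [Fintype Γ]
    (A B : Mould Γ) (hA : IsARI A) (hB : IsARI B)
    (hAal : IsBialternal A) (hBal : IsBialternal B) :
    IsBialternal (ariU A B) ∧ IsARI (ariU A B) := by
  obtain ⟨a1, a2, a3⟩ := hAal
  obtain ⟨b1, b2, b3⟩ := hBal
  rw [isAlternal_iff] at a1 b1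
  rw [isAlternal_swapM_iff] at a2 b2
  have hA0 := evalM_nil hA
  have hB0 := evalM_nil hB
  refine ⟨⟨?_, ?_, fun σ t => ?_⟩, fun σ x => ?_⟩
  · rw [isAlternal_iff, evalM_ariU hA hB]
    exact alt_ariW a1 b1 hA0 hB0
  · rw [isAlternal_swapM_iff, evalM_ariU hA hB]
    exact alt_swapF_ariW a1 b1 a2 b2 hA0 hB0 (evalM_singleton_neg a3) (evalM_singleton_neg b3)
  · rw [← evalM_ofFn (ariU A B), ← evalM_ofFn (ariU A B), evalM_ariU hA hB]
    simp [ariW_singleton hA0 hB0]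
  · rw [← evalM_ofFn (ariU A B), evalM_ariU hA hB]
    simp [ariW_nil hA0 hB0]

end KVMould
end

section
/- Proposition: If A and B ∈ ARI(Γ) are push-invariant, then ari_u(A,B) is push-invariant; consequently the set of push-invariant moulds is a Lie subalgebra of (ARI(Γ), ari_u). -/
namespace KVMould

variable {Γ : Type} [CommGroup Γ]

/-- Evaluation of the depth `p` component of a mould on the first `p` terms of two sequences. -/
def evalSeq (M : Mould Γ) (p : ℕ) (g : ℕ → Γ) (u : ℕ → ℚ) : ℚ :=
  M p (fun j => g j.val) (fun j => u j.val)

lemma apply_eq_evalSeq {Γ : Type} (M : Mould Γ) {p q : ℕ} (hpq : p = q) {σ : Fin p → Γ}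
    {x : Fin p → ℚ} {g : ℕ → Γ} {u : ℕ → ℚ} (hg : ∀ j (hj : j < p), σ ⟨j, hj⟩ = g j)
    (hu : ∀ j (hj : j < p), x ⟨j, hj⟩ = u j) : M p σ x = evalSeq M q g u := by
  subst hpq
  exact congrArg₂ (M p) (funext fun j => hg j j.2) (funext fun j => hu j j.2)

lemma evalSeq_congr {Γ : Type} (M : Mould Γ) {p q : ℕ} (hpq : p = q) {g g' : ℕ → Γ}
    {u u' : ℕ → ℚ} (hg : ∀ j < p, g j = g' j) (hu : ∀ j < p, u j = u' j) :
    evalSeq M p g u = evalSeq M q g' u' :=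
  apply_eq_evalSeq M hpq hg hu

lemma IsARI.evalSeq_zero {Γ : Type} {M : Mould Γ} (hM : IsARI M) (g : ℕ → Γ) (u : ℕ → ℚ) :
    evalSeq M 0 g u = 0 := hM _ _

lemma extG_apply {m i : ℕ} (g : ℕ → Γ) (hi : i < m) :
    extG (fun j : Fin m => g j.val) i = g i := dif_pos hi

lemma extQ_apply {m i : ℕ} (u : ℕ → ℚ) (hi : i < m) :
    extQ (fun j : Fin m => u j.val) i = u i := dif_pos hi

lemma sum_range_shift_of_periodic {n : ℕ} {f : ℕ → ℚ} (hf : Function.Periodic f n) (t : ℕ) :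
    ∑ i ∈ Finset.range n, f (t + i) = ∑ i ∈ Finset.range n, f i := by
  induction t with
  | zero => simp
  | succ t ih =>
    rw [← ih]
    have h₁ := Finset.sum_range_succ (fun i => f (t + i)) n
    have h₂ := Finset.sum_range_succ' (fun i => f (t + i)) n
    have h₃ : ∑ i ∈ Finset.range n, f (t + 1 + i) = ∑ i ∈ Finset.range n, f (t + (i + 1)) :=
      Finset.sum_congr rfl fun i _ => by congr 1; ring
    have h₄ : f (t + n) = f (t + 0) := hf t
    linarith

lemma evalSeq_pushM (M : Mould Γ) (p : ℕ) (g : ℕ → Γ) (u : ℕ → ℚ) :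
    evalSeq (pushM M) p g u =
      evalSeq M p (fun i => if i = 0 then (g (p - 1))⁻¹ else g (i - 1) * (g (p - 1))⁻¹)
        (fun i => if i = 0 then -∑ j ∈ Finset.range p, u j else u (i - 1)) := by
  unfold evalSeq pushM
  congr 1
  · funext i
    have hi := i.2
    rw [extG_apply g (by omega), extG_apply g (by omega)]
  · funext i
    have hi := i.2
    rw [extQ_apply u (by omega),
      Finset.sum_congr rfl fun j hj => extQ_apply u (Finset.mem_range.1 hj)]

/-- A push-invariant mould, viewed as a function on cyclic words of total weight zero, is invariant
under rotation. -/
lemma evalSeq_rotate {M : Mould Γ} (hM : pushM M = M) {p : ℕ} {g : ℕ → Γ} {u : ℕ → ℚ}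
    (hg : Function.Periodic g (p + 1)) (hu : Function.Periodic u (p + 1))
    (hsum : ∑ i ∈ Finset.range (p + 1), u i = 0) (t : ℕ) :
    evalSeq M p (fun j => g (t + 1 + j) * (g t)⁻¹) (fun j => u (t + 1 + j)) =
      evalSeq M p (fun j => g (1 + j) * (g 0)⁻¹) (fun j => u (1 + j)) := by
  induction t with
  | zero => simp
  | succ t ih =>
    rw [← ih]
    conv_lhs => rw [← hM]
    rw [evalSeq_pushM]
    refine evalSeq_congr M rfl (fun j hj => ?_) (fun j hj => ?_)
    · have h : g (t + 1 + 1 + (p - 1)) = g t := by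
        rw [← hg t]; congr 1; omega
      rcases j with _ | j
      · simp [h]
      · have : t + 1 + 1 + j = t + 1 + (j + 1) := by omega
        simp [h, this]
    · rcases j with _ | j
      · have h := sum_range_shift_of_periodic hu (t + 1)
        rw [hsum, Finset.sum_range_succ'] at h
        have h' : ∑ i ∈ Finset.range p, u (t + 1 + 1 + i) =
            ∑ i ∈ Finset.range p, u (t + 1 + (i + 1)) :=
          Finset.sum_congr rfl fun i _ => by congr 1; ring
        simp only [if_true]
        linarith
      · simp only [Nat.add_one_ne_zero, if_false]
        congr 1
        omega

/-- Contracting the block `K, …, K + a` of a cyclic word to a single letter with label `c`, and then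
rotating so that this letter is the omitted one. -/
lemma evalSeq_contract {M : Mould Γ} (hM : pushM M = M) {p a K : ℕ} (hK : 1 ≤ K) (hKp : K ≤ p)
    {G : ℕ → Γ} {X : ℕ → ℚ} (hG : Function.Periodic G (p + a + 1))
    (hX : Function.Periodic X (p + a + 1)) (hG0 : G 0 = 1)
    (hsum : ∑ i ∈ Finset.range (p + a + 1), X i = 0) (c : Γ) :
    evalSeq M p
        (fun j => if j + 1 < K then G (j + 1) else if j + 1 = K then c else G (j + 1 + a))
        (fun j => if j + 1 < K then X (j + 1)
          else if j + 1 = K then ∑ r ∈ Finset.range (a + 1), X (K + r) else X (j + 1 + a)) =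
      evalSeq M p (fun j => G (K + a + 1 + j) * c⁻¹) (fun j => X (K + a + 1 + j)) := by
  set s := ∑ r ∈ Finset.range (a + 1), X (K + r) with hs
  let g₀ : ℕ → Γ := fun r => if r < K then G r else if r = K then c else G (r + a)
  let u₀ : ℕ → ℚ := fun r => if r < K then X r else if r = K then s else X (r + a)
  have hg : Function.Periodic (fun i => g₀ (i % (p + 1))) (p + 1) := fun i => by simp
  have hu : Function.Periodic (fun i => u₀ (i % (p + 1))) (p + 1) := fun i => by simp
  have husum : ∑ i ∈ Finset.range (p + 1), u₀ (i % (p + 1)) = 0 := by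
    obtain ⟨q, rfl⟩ := Nat.exists_eq_add_of_le hKp
    rw [Finset.sum_congr rfl fun i hi => by rw [Nat.mod_eq_of_lt (Finset.mem_range.1 hi)], ← hsum,
      show K + q + 1 = K + 1 + q by ring, show K + q + a + 1 = K + (a + 1) + q by ring,
      Finset.sum_range_add u₀, Finset.sum_range_add u₀, Finset.sum_range_add X,
      Finset.sum_range_add X, Finset.sum_range_one, ← hs]
    congr 1
    · congr 1
      · exact Finset.sum_congr rfl fun i hi => if_pos (Finset.mem_range.1 hi)
      · simp [u₀]
    · refine Finset.sum_congr rfl fun i _ => ?_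
      have h₁ : ¬ K + 1 + i < K := by omega
      have h₂ : ¬ K + 1 + i = K := by omega
      simp only [u₀, h₁, h₂, if_false]
      congr 1
      ring
  have key := evalSeq_rotate hM hg hu husum K
  have hmod : ∀ j < p, (K + 1 + j) % (p + 1) = K + 1 + j ∧ K + 1 + j < p + 1 ∨
      (K + 1 + j) % (p + 1) < K ∧ (K + 1 + j) % (p + 1) + (p + a + 1) = K + a + 1 + j := by
    intro j hj
    by_cases h : K + 1 + j < p + 1
    · exact Or.inl ⟨Nat.mod_eq_of_lt h, h⟩
    · right
      rw [Nat.mod_eq_sub_mod (by omega), Nat.mod_eq_of_lt (by omega)]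
      omega
  refine Eq.trans ?_ (key.symm.trans ?_)
  · refine evalSeq_congr M rfl (fun j hj => ?_) (fun j hj => ?_)
    · have h0 : g₀ (0 % (p + 1)) = 1 := by
        have : 0 < K := hK
        simp [g₀, this, hG0]
      rw [h0, Nat.mod_eq_of_lt (by omega), add_comm 1 j]
      simp [g₀]
    · rw [Nat.mod_eq_of_lt (by omega), add_comm 1 j]
  · have hc : g₀ (K % (p + 1)) = c := by
      rw [Nat.mod_eq_of_lt (by omega)]
      simp [g₀]
    refine evalSeq_congr M rfl (fun j hj => ?_) (fun j hj => ?_)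
    · rw [hc]
      congr 1
      rcases hmod j hj with ⟨h, _⟩ | ⟨h, h'⟩
      · rw [h]
        have h₁ : ¬ K + 1 + j < K := by omega
        have h₂ : ¬ K + 1 + j = K := by omega
        simp only [g₀, h₁, h₂, if_false]
        congr 1
        ring
      · rw [← h', hG]
        simp only [g₀, h, if_true]
    · rcases hmod j hj with ⟨h, _⟩ | ⟨h, h'⟩
      · rw [h]
        have h₁ : ¬ K + 1 + j < K := by omega
        have h₂ : ¬ K + 1 + j = K := by omega
        simp only [u₀, h₁, h₂, if_false]
        congr 1
        ring
      · rw [← h', hX]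
        simp only [u₀, h, if_true]

/-- The term of `A × B` in which `A` has depth `i`, for the cyclic word `(G, X)` of length `m + 1`
read starting after its letter number `t`. -/
def cyclicTerm (A B : Mould Γ) (m : ℕ) (G : ℕ → Γ) (X : ℕ → ℚ) (t i : ℕ) : ℚ :=
  evalSeq A i (fun j => G (t + 1 + j) * (G t)⁻¹) (fun j => X (t + 1 + j)) *
    evalSeq B (m - i) (fun j => G (t + 1 + i + j) * (G t)⁻¹) (fun j => X (t + 1 + i + j))

lemma mouldMul_eq_sum_cyclicTerm (A B : Mould Γ) (m : ℕ) {G : ℕ → Γ} (X : ℕ → ℚ) (hG0 : G 0 = 1) :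
    evalSeq (mouldMul A B) m (fun j => G (j + 1)) (fun j => X (j + 1)) =
      ∑ i ∈ Finset.range (m + 1), cyclicTerm A B m G X 0 i := by
  rw [evalSeq, mouldMul]
  refine Finset.sum_congr rfl fun k hk => ?_
  have hk' := Finset.mem_range.1 hk
  refine congrArg₂ (· * ·) (apply_eq_evalSeq A rfl (fun j hj => ?_) (fun j hj => ?_))
    (apply_eq_evalSeq B rfl (fun j hj => ?_) (fun j hj => ?_))
  · rw [extG_apply (fun j => G (j + 1)) (by omega), hG0, inv_one, mul_one]
    congr 1
    ring
  · rw [extQ_apply (fun j => X (j + 1)) (by omega)]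
    congr 1
    ring
  · rw [extG_apply (fun j => G (j + 1)) (by omega), hG0, inv_one, mul_one]
    congr 1
    ring
  · rw [extQ_apply (fun j => X (j + 1)) (by omega)]
    congr 1
    ring

lemma aritU_eq_sum_cyclicTerm {A : Mould Γ} (hA : pushM A = A) (B : Mould Γ) {m : ℕ}
    {G : ℕ → Γ} {X : ℕ → ℚ} (hG : Function.Periodic G (m + 1)) (hX : Function.Periodic X (m + 1))
    (hG0 : G 0 = 1) (hsum : ∑ i ∈ Finset.range (m + 1), X i = 0) :
    evalSeq (aritU B A) m (fun j => G (j + 1)) (fun j => X (j + 1)) =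
      (∑ k ∈ Finset.range m, ∑ l ∈ Finset.range m,
        if k ≤ l ∧ l + 1 < m then cyclicTerm A B m G X (l + 2) (m - (l - k + 1)) else 0) -
      ∑ k ∈ Finset.range m, ∑ l ∈ Finset.range m,
        if 1 ≤ k ∧ k ≤ l then cyclicTerm B A m G X k (l - k + 1) else 0 := by
  have hIcc : ∀ k l, k ≤ l → l < m →
      ∑ i ∈ Finset.Icc k l, extQ (fun j : Fin m => X (j.val + 1)) i =
        ∑ r ∈ Finset.range (l - k + 1), X (k + 1 + r) := by
    intro k l hkl hl
    have : Finset.Icc k l = Finset.Ico k (l + 1) := by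
      ext i
      simp only [Finset.mem_Icc, Finset.mem_Ico]
      omega
    rw [this, Finset.sum_Ico_eq_sum_range, show l + 1 - k = l - k + 1 by omega]
    refine Finset.sum_congr rfl fun r hr => ?_
    have := Finset.mem_range.1 hr
    rw [extQ_apply (fun j => X (j + 1)) (by omega)]
    congr 1
    ring
  rw [evalSeq, aritU]
  refine congrArg₂ (· - ·)
    (Finset.sum_congr rfl fun k _ => Finset.sum_congr rfl fun l hl => ?_)
    (Finset.sum_congr rfl fun k _ => Finset.sum_congr rfl fun l hl => ?_)
  · split_ifs with h
    · obtain ⟨hkl, hlm⟩ := h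
      obtain ⟨a, ha⟩ : ∃ a, l - k + 1 = a := ⟨_, rfl⟩
      obtain ⟨p, hp⟩ : ∃ p, m - a = p := ⟨_, rfl⟩
      have hm : m + 1 = p + a + 1 := by omega
      have hcontr := evalSeq_contract hA (p := p) (a := a) (K := k + 1) (by omega) (by omega)
        (hm ▸ hG) (hm ▸ hX) hG0 (hm ▸ hsum) (G (l + 2))
      rw [ha, hp]
      refine congrArg₂ (· * ·) (Eq.trans ?_ (hcontr.trans ?_)) ?_
      · refine apply_eq_evalSeq A rfl (fun j hj => ?_) (fun j hj => ?_)
        · dsimp only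
          rcases lt_trichotomy j k with h | h | h
          · rw [if_pos h, if_pos (by omega), extG_apply (fun j => G (j + 1)) (by omega)]
          · rw [if_neg (by omega), if_pos h, if_neg (by omega), if_pos (by omega),
              extG_apply (fun j => G (j + 1)) (by omega)]
          · rw [if_neg (by omega), if_neg (by omega), if_neg (by omega), if_neg (by omega),
              extG_apply (fun j => G (j + 1)) (by omega)]
            congr 1
            omega
        · dsimp only
          rcases lt_trichotomy j k with h | h | h
          · rw [if_pos h, if_pos (by omega), extQ_apply (fun j => X (j + 1)) (by omega)]
          · rw [if_neg (by omega), if_pos h, if_neg (by omega), if_pos (by omega),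
              hIcc k (l + 1) (by omega) (by omega), show l + 1 - k + 1 = a + 1 by omega]
          · rw [if_neg (by omega), if_neg (by omega), if_neg (by omega), if_neg (by omega),
              extQ_apply (fun j => X (j + 1)) (by omega)]
            congr 1
            omega
      · have : k + 1 + a = l + 2 := by omega
        rw [this]
      · refine apply_eq_evalSeq B (by omega) (fun j hj => ?_) (fun j hj => ?_)
        · rw [extG_apply (fun j => G (j + 1)) (by omega),
            extG_apply (fun j => G (j + 1)) (by omega), ← hG (k + j + 1)]
          congr 2
          omega
        · rw [extQ_apply (fun j => X (j + 1)) (by omega), ← hX (k + j + 1)]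
          congr 1
          omega
    · rfl
  · split_ifs with h
    · obtain ⟨hk, hkl⟩ := h
      have hlm := Finset.mem_range.1 hl
      obtain ⟨a, ha⟩ : ∃ a, l - k + 1 = a := ⟨_, rfl⟩
      obtain ⟨p, hp⟩ : ∃ p, m - a = p := ⟨_, rfl⟩
      have hm : m + 1 = p + a + 1 := by omega
      have hcontr := evalSeq_contract hA (p := p) (a := a) (K := k) (by omega) (by omega)
        (hm ▸ hG) (hm ▸ hX) hG0 (hm ▸ hsum) (G k)
      have hkk : k - 1 + 1 = k := by omega
      rw [ha, hp, cyclicTerm, mul_comm (evalSeq B _ _ _), hp]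
      refine congrArg₂ (· * ·) (Eq.trans ?_ (hcontr.trans ?_)) ?_
      · refine apply_eq_evalSeq A rfl (fun j hj => ?_) (fun j hj => ?_)
        · dsimp only
          rcases lt_trichotomy j (k - 1) with h | h | h
          · rw [if_pos h, if_pos (by omega), extG_apply (fun j => G (j + 1)) (by omega)]
          · rw [if_neg (by omega), if_pos h, if_neg (by omega), if_pos (by omega),
              extG_apply (fun j => G (j + 1)) (by omega), hkk]
          · rw [if_neg (by omega), if_neg (by omega), if_neg (by omega), if_neg (by omega),
              extG_apply (fun j => G (j + 1)) (by omega)]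
            congr 1
            omega
        · dsimp only
          rcases lt_trichotomy j (k - 1) with h | h | h
          · rw [if_pos h, if_pos (by omega), extQ_apply (fun j => X (j + 1)) (by omega)]
          · rw [if_neg (by omega), if_pos h, if_neg (by omega), if_pos (by omega),
              hIcc (k - 1) l (by omega) (by omega), hkk,
              show l - (k - 1) + 1 = a + 1 by omega]
          · rw [if_neg (by omega), if_neg (by omega), if_neg (by omega), if_neg (by omega),
              extQ_apply (fun j => X (j + 1)) (by omega)]
            congr 1
            omega
      · have : k + a + 1 = k + 1 + a := by omega
        rw [this]
      · refine apply_eq_evalSeq B rfl (fun j hj => ?_) (fun j hj => ?_)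
        · dsimp only
          rw [extG_apply (fun j => G (j + 1)) (by omega),
            extG_apply (fun j => G (j + 1)) (by omega), hkk]
          congr 2
          omega
        · dsimp only
          rw [extQ_apply (fun j => X (j + 1)) (by omega)]
          congr 1
          omega
    · rfl

lemma sum_blocks_add_sum_blocks (m : ℕ) (w : ℕ → ℕ → ℚ) (h0 : ∀ t, w t 0 = 0)
    (hm : ∀ t, w t m = 0) :
    (∑ k ∈ Finset.range m, ∑ l ∈ Finset.range m,
        if k ≤ l ∧ l + 1 < m then w (l + 2) (m - (l - k + 1)) else 0) +
      (∑ k ∈ Finset.range m, ∑ l ∈ Finset.range m,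
        if 1 ≤ k ∧ k ≤ l then w k (l - k + 1) else 0) +
      ∑ i ∈ Finset.range (m + 1), w 0 i =
    ∑ t ∈ Finset.range (m + 1), ∑ i ∈ Finset.range (m + 1), w t i := by
  rw [Finset.sum_range_succ' (fun t => ∑ i ∈ Finset.range (m + 1), w t i)]
  congr 1
  have hsplit : ∀ t ∈ Finset.range m, ∑ i ∈ Finset.range (m + 1), w (t + 1) i =
      (∑ i ∈ Finset.range (m + 1), if m < t + 1 + i ∧ i < m then w (t + 1) i else 0) +
        ∑ i ∈ Finset.range (m + 1), if t + 1 + i ≤ m ∧ 1 ≤ i then w (t + 1) i else 0 := by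
    intro t _
    rw [← Finset.sum_add_distrib]
    refine Finset.sum_congr rfl fun i hi => ?_
    have := Finset.mem_range.1 hi
    rcases Nat.eq_zero_or_pos i with rfl | hpos
    · simp [h0]
    · rcases Nat.lt_or_ge i m with him | him
      · by_cases h : m < t + 1 + i
        · rw [if_pos ⟨h, him⟩, if_neg (by omega), add_zero]
        · rw [if_neg (by omega), if_pos (by omega), zero_add]
      · obtain rfl : i = m := by omega
        simp [hm]
  rw [Finset.sum_congr rfl hsplit, Finset.sum_add_distrib]
  rw [← Finset.sum_product', ← Finset.sum_product', ← Finset.sum_product',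
    ← Finset.sum_product']
  simp only [← Finset.sum_filter]
  congr 1
  · refine Finset.sum_nbij' (fun q => (q.2 + 1, m - (q.2 - q.1 + 1)))
      (fun q => (q.1 + q.2 - m, q.1 - 1)) ?_ ?_ ?_ ?_ ?_ <;>
      simp only [Finset.mem_filter, Finset.mem_product, Finset.mem_range, Prod.forall,
        Prod.mk.injEq] <;> intro k l h
    · omega
    · omega
    · omega
    · omega
    · trivial
  · refine Finset.sum_nbij' (fun q => (q.1 - 1, q.2 - q.1 + 1))
      (fun q => (q.1 + 1, q.1 + q.2)) ?_ ?_ ?_ ?_ ?_ <;>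
      simp only [Finset.mem_filter, Finset.mem_product, Finset.mem_range, Prod.forall,
        Prod.mk.injEq] <;> intro k l h
    · omega
    · omega
    · omega
    · omega
    · rw [show k - 1 + 1 = k by omega]

/-- For push-invariant moulds the `ari_u`-bracket is the sum of all rotations of the commutator for
the mould product. -/
lemma ariU_eq_sum_cyclicTerm {A B : Mould Γ} (hA : IsARI A) (hB : IsARI B)
    (hApush : pushM A = A) (hBpush : pushM B = B) {m : ℕ} {G : ℕ → Γ} {X : ℕ → ℚ}
    (hG : Function.Periodic G (m + 1)) (hX : Function.Periodic X (m + 1))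
    (hG0 : G 0 = 1) (hsum : ∑ i ∈ Finset.range (m + 1), X i = 0) :
    evalSeq (ariU A B) m (fun j => G (j + 1)) (fun j => X (j + 1)) =
      ∑ t ∈ Finset.range (m + 1), ((∑ i ∈ Finset.range (m + 1), cyclicTerm A B m G X t i) -
        ∑ i ∈ Finset.range (m + 1), cyclicTerm B A m G X t i) := by
  have hzero : ∀ {M N : Mould Γ}, IsARI M → ∀ t, cyclicTerm M N m G X t 0 = 0 := fun hM t => by
    rw [cyclicTerm, hM.evalSeq_zero, zero_mul]
  have htop : ∀ {M N : Mould Γ}, IsARI N → ∀ t, cyclicTerm M N m G X t m = 0 := fun hN t => by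
    rw [cyclicTerm, Nat.sub_self, hN.evalSeq_zero, mul_zero]
  rw [Finset.sum_sub_distrib,
    ← sum_blocks_add_sum_blocks m (cyclicTerm A B m G X) (hzero hA) (htop hB),
    ← sum_blocks_add_sum_blocks m (cyclicTerm B A m G X) (hzero hB) (htop hA),
    ← mouldMul_eq_sum_cyclicTerm A B m X hG0, ← mouldMul_eq_sum_cyclicTerm B A m X hG0]
  have h₁ := aritU_eq_sum_cyclicTerm hApush B hG hX hG0 hsum
  have h₂ := aritU_eq_sum_cyclicTerm hBpush A hG hX hG0 hsum
  have h₃ : ∀ g u, evalSeq (ariU A B) m g u = evalSeq (aritU B A) m g u -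
    evalSeq (aritU A B) m g u + evalSeq (mouldMul A B) m g u - evalSeq (mouldMul B A) m g u :=
    fun _ _ => rfl
  rw [h₃, h₁, h₂]
  ring

lemma cyclicTerm_shift (A B : Mould Γ) (m : ℕ) (G : ℕ → Γ) (X : ℕ → ℚ) (c : Γ) (s t i : ℕ) :
    cyclicTerm A B m (fun j => G (s + j) * c) (fun j => X (s + j)) t i =
      cyclicTerm A B m G X (s + t) i := by
  unfold cyclicTerm
  simp only [mul_inv_rev, mul_mul_mul_comm _ c, add_assoc]
  simp [mul_assoc]

lemma cyclicTerm_periodic (A B : Mould Γ) {m : ℕ} {G : ℕ → Γ} {X : ℕ → ℚ}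
    (hG : Function.Periodic G (m + 1)) (hX : Function.Periodic X (m + 1)) (i : ℕ) :
    Function.Periodic (fun t => cyclicTerm A B m G X t i) (m + 1) := by
  intro t
  have hG' : (fun j => G (m + 1 + j) * 1) = G := funext fun j => by rw [mul_one, add_comm, hG]
  have hX' : (fun j => X (m + 1 + j)) = X := funext fun j => by rw [add_comm, hX]
  have := cyclicTerm_shift A B m G X 1 (m + 1) t i
  rw [hG', hX'] at this
  simp only [add_comm t, this]

/-- Proposition: the `ari_u`-bracket of push-invariant ARI moulds is again
push-invariant; hence push-invariant moulds form a Lie subalgebra. -/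
theorem ariU_pushInvariant (Γ : Type) [CommGroup Γ] [Fintype Γ]
    (A B : Mould Γ) (hA : IsARI A) (hB : IsARI B)
    (hApush : pushM A = A) (hBpush : pushM B = B) :
    pushM (ariU A B) = ariU A B := by
  funext m σ x
  let G : ℕ → Γ := fun i => if i % (m + 1) = 0 then 1 else extG σ (i % (m + 1) - 1)
  let X : ℕ → ℚ := fun i => if i % (m + 1) = 0 then -∑ j ∈ Finset.range m, extQ x j
    else extQ x (i % (m + 1) - 1)
  have hG : Function.Periodic G (m + 1) := fun i => by simp [G]
  have hX : Function.Periodic X (m + 1) := fun i => by simp [X]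
  have hG0 : G 0 = 1 := by simp [G]
  have hX0 : X 0 = -∑ j ∈ Finset.range m, extQ x j := by simp [X]
  have hGs : ∀ j < m, G (j + 1) = extG σ j := fun j hj => by
    simp [G, Nat.mod_eq_of_lt (show j + 1 < m + 1 by omega)]
  have hXs : ∀ j < m, X (j + 1) = extQ x j := fun j hj => by
    simp [X, Nat.mod_eq_of_lt (show j + 1 < m + 1 by omega)]
  have hsum : ∑ i ∈ Finset.range (m + 1), X i = 0 := by
    rw [Finset.sum_range_succ', hX0,
      Finset.sum_congr rfl fun j hj => hXs j (Finset.mem_range.1 hj), add_neg_cancel]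
  have hG' : Function.Periodic (fun j => G (m + j) * (G m)⁻¹) (m + 1) := fun i => by
    simp only [← add_assoc m i, hG (m + i)]
  have hX' : Function.Periodic (fun j => X (m + j)) (m + 1) := fun i => by
    simp only [← add_assoc m i, hX (m + i)]
  have hsum' : ∑ i ∈ Finset.range (m + 1), X (m + i) = 0 := by
    rw [sum_range_shift_of_periodic hX, hsum]
  have hGw : ∀ j, G (m + (j + 1)) = G j := fun j => by
    rw [← hG j]; congr 1; ring
  have hXw : ∀ j, X (m + (j + 1)) = X j := fun j => by
    rw [← hX j]; congr 1; ring
  have hbase : ariU A B m σ x = evalSeq (ariU A B) m (fun j => G (j + 1)) (fun j => X (j + 1)) := by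
    refine apply_eq_evalSeq (ariU A B) rfl (fun j hj => ?_) (fun j hj => ?_)
    · rw [hGs j hj, extG, dif_pos hj]
    · rw [hXs j hj, extQ, dif_pos hj]
  have hpush : pushM (ariU A B) m σ x = evalSeq (ariU A B) m
      (fun j => G (m + (j + 1)) * (G m)⁻¹) (fun j => X (m + (j + 1))) := by
    refine apply_eq_evalSeq (ariU A B) rfl (fun j hj => ?_) (fun j hj => ?_)
    · have hGm : G m = extG σ (m - 1) := by
        rw [← hGs (m - 1) (by omega)]; congr 1; omega
      rw [hGw, hGm]
      dsimp only
      split_ifs with h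
      · rw [h, hG0, one_mul]
      · rw [← hGs (j - 1) (by omega), show j - 1 + 1 = j by omega]
    · rw [hXw]
      dsimp only
      split_ifs with h
      · rw [h, hX0]
      · rw [← hXs (j - 1) (by omega), show j - 1 + 1 = j by omega]
  rw [hbase, hpush, ariU_eq_sum_cyclicTerm hA hB hApush hBpush hG hX hG0 hsum,
    ariU_eq_sum_cyclicTerm hA hB hApush hBpush hG' hX' (by simp) hsum']
  simp only [cyclicTerm_shift]
  refine sum_range_shift_of_periodic (f := fun t =>
    (∑ i ∈ Finset.range (m + 1), cyclicTerm A B m G X t i) -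
      ∑ i ∈ Finset.range (m + 1), cyclicTerm B A m G X t i) (fun t => ?_) m
  exact congrArg₂ (· - ·)
    (Finset.sum_congr rfl fun i _ => cyclicTerm_periodic A B hG hX i t)
    (Finset.sum_congr rfl fun i _ => cyclicTerm_periodic B A hG hX i t)

end KVMould
end
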